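/- arXiv:0804.4789 — 2 statements merged into one kernel-verified Lean document; each statement's English description precedes it below -/
import Mathlib

section
/- Let g ≥ 2 and let d ≥ 2 be an even integer. Then the abelianization H_1(Γ_g[d];ℤ) = Γ_g[d]/[Γ_g[d],Γ_g[d]] is isomorphic as a group to (ℤ/dℤ)^{2g²−g} × (ℤ/2dℤ)^{2g}. -/
open Matrix

/-- The index type for `2g × 2g` matrices, written as `Fin g ⊕ Fin g`. -/
abbrev Idx (g : ℕ) := Fin g ⊕ Fin g

/-- The integral symplectic group `Sp(2g; ℤ)`. -/
abbrev SpZ (g : ℕ) := Matrix.symplecticGroup (Fin g) ℤ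

/-- Entrywise reduction of integral matrices mod `d`. -/
def modred (g d : ℕ) : Matrix (Idx g) (Idx g) ℤ →+* Matrix (Idx g) (Idx g) (ZMod d) :=
  (Int.castRingHom (ZMod d)).mapMatrix

/-- The level `d` congruence subgroup `Γ_g[d]` of `Sp(2g; ℤ)`:
matrices congruent to the identity mod `d`. -/
def Gamma (g d : ℕ) : Subgroup ↥(SpZ g) where
  carrier := {A | modred g d (A : Matrix (Idx g) (Idx g) ℤ) = 1}
  one_mem' := by
    simp [Set.mem_setOf_eq]
  mul_mem' := by
    intro a b ha hb
    simp only [Set.mem_setOf_eq, Submonoid.coe_mul, _root_.map_mul] at *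
    rw [ha, hb, one_mul]
  inv_mem' := by
    intro a ha
    simp only [Set.mem_setOf_eq] at *
    have h : modred g d ((a⁻¹ : ↥(SpZ g)) : Matrix (Idx g) (Idx g) ℤ) *
        modred g d ((a : ↥(SpZ g)) : Matrix (Idx g) (Idx g) ℤ) = 1 := by
      rw [← _root_.map_mul, ← Submonoid.coe_mul, inv_mul_cancel, Submonoid.coe_one, _root_.map_one]
    calc modred g d ((a⁻¹ : ↥(SpZ g)) : Matrix (Idx g) (Idx g) ℤ)
        = modred g d ((a⁻¹ : ↥(SpZ g)) : Matrix (Idx g) (Idx g) ℤ) *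
            modred g d ((a : ↥(SpZ g)) : Matrix (Idx g) (Idx g) ℤ) := by rw [ha, mul_one]
      _ = 1 := h

lemma mem_Gamma_iff {g d : ℕ} {A : ↥(SpZ g)} :
    A ∈ Gamma g d ↔ ∀ i j : Idx g, (d : ℤ) ∣
      ((A : Matrix (Idx g) (Idx g) ℤ) i j - (1 : Matrix (Idx g) (Idx g) ℤ) i j) := by
  have : A ∈ Gamma g d ↔ modred g d (A : Matrix (Idx g) (Idx g) ℤ) = 1 := Iff.rfl
  rw [this, ← Matrix.ext_iff]
  constructor
  · intro h i j
    have hij := h i j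
    simp only [modred, RingHom.mapMatrix_apply, Matrix.map_apply, Int.coe_castRingHom] at hij
    have h1 : ((1 : Matrix (Idx g) (Idx g) ℤ) i j : ZMod d) = (1 : Matrix (Idx g) (Idx g) (ZMod d)) i j := by
      by_cases hij' : i = j <;> simp [Matrix.one_apply, hij']
    rw [← h1] at hij
    rw [← ZMod.intCast_zmod_eq_zero_iff_dvd]
    push_cast
    rw [hij]
    ring
  · intro h i j
    have hij := h i j
    rw [← ZMod.intCast_zmod_eq_zero_iff_dvd] at hij
    push_cast at hij
    simp only [modred, RingHom.mapMatrix_apply, Matrix.map_apply, Int.coe_castRingHom]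
    have h1 : ((1 : Matrix (Idx g) (Idx g) ℤ) i j : ZMod d) = (1 : Matrix (Idx g) (Idx g) (ZMod d)) i j := by
      by_cases hij' : i = j <;> simp [Matrix.one_apply, hij']
    rw [← h1]
    linear_combination hij

namespace SpLevel

variable {g : ℕ}

/-- The lattice `ℤ^{2g}` on which the symplectic group acts. -/
abbrev Lat (g : ℕ) := Idx g → ℤ

/-- The standard symplectic form on `ℤ^{2g}`. -/
def om : Lat g →ₗ[ℤ] Lat g →ₗ[ℤ] ℤ :=
  LinearMap.mk₂ ℤ
    (fun x y => ∑ k, (x (Sum.inl k) * y (Sum.inr k) - x (Sum.inr k) * y (Sum.inl k)))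
    (fun x x' y => by
      rw [← Finset.sum_add_distrib]; exact Finset.sum_congr rfl fun k _ => by
        simp only [Pi.add_apply]; ring)
    (fun c x y => by
      rw [smul_eq_mul, Finset.mul_sum]; exact Finset.sum_congr rfl fun k _ => by
        simp only [Pi.smul_apply, smul_eq_mul]; ring)
    (fun x y y' => by
      rw [← Finset.sum_add_distrib]; exact Finset.sum_congr rfl fun k _ => by
        simp only [Pi.add_apply]; ring)
    (fun c x y => by
      rw [smul_eq_mul, Finset.mul_sum]; exact Finset.sum_congr rfl fun k _ => by
        simp only [Pi.smul_apply, smul_eq_mul]; ring)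

lemma om_apply (x y : Lat g) : om x y =
    ∑ k, (x (Sum.inl k) * y (Sum.inr k) - x (Sum.inr k) * y (Sum.inl k)) := rfl

lemma om_swap (x y : Lat g) : om x y = - om y x := by
  rw [om_apply, om_apply, ← Finset.sum_neg_distrib]
  exact Finset.sum_congr rfl fun k _ => by ring

@[simp] lemma om_self (x : Lat g) : om x x = 0 := by
  have := om_swap x x
  omega

/-- The basis vectors spanning the first Lagrangian. -/
def ee (k : Fin g) : Lat g := Pi.single (Sum.inl k) 1

/-- The basis vectors spanning the second Lagrangian. -/
def ff (k : Fin g) : Lat g := Pi.single (Sum.inr k) 1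

lemma ee_inl (k i : Fin g) : ee k (Sum.inl i) = if i = k then 1 else 0 := by
  simp [ee, Pi.single_apply]

@[simp] lemma ee_inr (k i : Fin g) : ee k (Sum.inr i) = 0 := by
  simp [ee]

@[simp] lemma ff_inl (k i : Fin g) : ff k (Sum.inl i) = 0 := by
  simp [ff]

lemma ff_inr (k i : Fin g) : ff k (Sum.inr i) = if i = k then 1 else 0 := by
  simp [ff, Pi.single_apply]

@[simp] lemma om_ee_left (k : Fin g) (x : Lat g) : om (ee k) x = x (Sum.inr k) := by
  simp [om_apply, ee_inl]

@[simp] lemma om_ff_left (k : Fin g) (x : Lat g) : om (ff k) x = - x (Sum.inl k) := by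
  simp [om_apply, ff_inr]

@[simp] lemma om_ee_right (k : Fin g) (x : Lat g) : om x (ee k) = - x (Sum.inr k) := by
  rw [om_swap, om_ee_left]

@[simp] lemma om_ff_right (k : Fin g) (x : Lat g) : om x (ff k) = x (Sum.inl k) := by
  rw [om_swap, om_ff_left, neg_neg]

/-- The action of the symplectic group on the lattice. -/
def act : SpZ g →* Module.End ℤ (Lat g) where
  toFun M := Matrix.mulVecLin (M : Matrix (Idx g) (Idx g) ℤ)
  map_one' := by simp; rfl
  map_mul' M N := by
    simp only [Submonoid.coe_mul, Matrix.mulVecLin_mul]; rfl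

lemma act_apply (M : SpZ g) (x : Lat g) :
    act M x = (M : Matrix (Idx g) (Idx g) ℤ) *ᵥ x := rfl

lemma act_ee (M : SpZ g) (k : Fin g) (i : Idx g) :
    act M (ee k) i = (M : Matrix (Idx g) (Idx g) ℤ) i (Sum.inl k) := by
  simp [act_apply, ee]

lemma act_ff (M : SpZ g) (k : Fin g) (i : Idx g) :
    act M (ff k) i = (M : Matrix (Idx g) (Idx g) ℤ) i (Sum.inr k) := by
  simp [act_apply, ff]

lemma act_injective : Function.Injective (act (g := g)) := by
  intro M N h
  apply Subtype.ext
  exact Matrix.mulVec_injective (funext fun x => LinearMap.congr_fun h x)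

lemma sp_ext {M N : SpZ g} (h : ∀ x, act M x = act N x) : M = N :=
  act_injective (LinearMap.ext h)

lemma lin_ext {A B : Lat g →ₗ[ℤ] Lat g} (he : ∀ k, A (ee k) = B (ee k))
    (hf : ∀ k, A (ff k) = B (ff k)) : A = B := by
  refine LinearMap.pi_ext' fun i => LinearMap.ext_ring ?_
  rcases i with i | i
  · exact he i
  · exact hf i

lemma sp_ext_basis {M N : SpZ g} (he : ∀ k, act M (ee k) = act N (ee k))
    (hf : ∀ k, act M (ff k) = act N (ff k)) : M = N :=
  act_injective (lin_ext he hf)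

@[simp] lemma act_mul_apply (M N : SpZ g) (x : Lat g) : act (M * N) x = act M (act N x) := by
  rw [map_mul]; rfl

@[simp] lemma act_one_apply (x : Lat g) : act (1 : SpZ g) x = x := by
  rw [map_one]; rfl

@[simp] lemma act_inv_act (M : SpZ g) (x : Lat g) : act M⁻¹ (act M x) = x := by
  rw [← act_mul_apply, inv_mul_cancel, act_one_apply]

@[simp] lemma act_act_inv (M : SpZ g) (x : Lat g) : act M (act M⁻¹ x) = x := by
  rw [← act_mul_apply, mul_inv_cancel, act_one_apply]

lemma act_inv_eq {M : SpZ g} {x y : Lat g} (h : act M x = y) : act M⁻¹ y = x := by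
  rw [← h, act_inv_act]

lemma om_eq_dotProduct (x y : Lat g) : om x y = - (x ⬝ᵥ (Matrix.J (Fin g) ℤ *ᵥ y)) := by
  rw [om_apply, dotProduct, Fintype.sum_sum_type]
  have h1 : ∀ k, (Matrix.J (Fin g) ℤ *ᵥ y) (Sum.inl k) = - y (Sum.inr k) := by
    intro k
    simp [Matrix.J, Matrix.mulVec, dotProduct, Fintype.sum_sum_type, Matrix.one_apply]
  have h2 : ∀ k, (Matrix.J (Fin g) ℤ *ᵥ y) (Sum.inr k) = y (Sum.inl k) := by
    intro k
    simp [Matrix.J, Matrix.mulVec, dotProduct, Fintype.sum_sum_type, Matrix.one_apply]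
  simp only [h1, h2, Finset.sum_sub_distrib, mul_neg, Finset.sum_neg_distrib]
  ring

lemma om_act (M : SpZ g) (x y : Lat g) : om (act M x) (act M y) = om x y := by
  rw [om_eq_dotProduct, om_eq_dotProduct, act_apply, act_apply, Matrix.mulVec_mulVec,
    Matrix.dotProduct_mulVec, ← Matrix.mulVec_transpose, Matrix.mulVec_mulVec,
    Matrix.transpose_mul, Matrix.J_transpose]
  rw [Matrix.dotProduct_mulVec, ← Matrix.mulVec_transpose, Matrix.J_transpose]
  have := SymplecticGroup.mem_iff'.mp M.2
  rw [Matrix.mul_neg, Matrix.neg_mul, this]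

lemma mem_sp_of_om {A : Matrix (Idx g) (Idx g) ℤ}
    (h : ∀ x y : Lat g, om (A *ᵥ x) (A *ᵥ y) = om x y) : A ∈ SpZ g := by
  rw [SymplecticGroup.mem_iff']
  refine Matrix.ext_of_mulVec_single fun j => funext fun i => ?_
  have := h (Pi.single i 1) (Pi.single j 1)
  rw [om_eq_dotProduct, om_eq_dotProduct, neg_inj, ← Matrix.vecMul_transpose,
    ← Matrix.dotProduct_mulVec, Matrix.mulVec_mulVec, Matrix.mulVec_mulVec] at this
  simpa only [single_one_dotProduct, Matrix.mul_assoc] using this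

/-- The symplectic matrix of a linear map preserving the symplectic form. -/
def mkSp (A : Lat g →ₗ[ℤ] Lat g) (h : ∀ x y, om (A x) (A y) = om x y) : SpZ g :=
  ⟨LinearMap.toMatrix' A, mem_sp_of_om fun x y => by
    rw [LinearMap.toMatrix'_mulVec, LinearMap.toMatrix'_mulVec, h]⟩

@[simp] lemma act_mkSp (A : Lat g →ₗ[ℤ] Lat g) (h) (x : Lat g) : act (mkSp A h) x = A x :=
  LinearMap.toMatrix'_mulVec A x

/-- The power `x ↦ x + c ω(u,x) u` of the symplectic transvection along `u`. -/
def tv (u : Lat g) (c : ℤ) : SpZ g :=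
  mkSp (LinearMap.id + c • (om u).smulRight u) fun x y => by
    simp only [LinearMap.add_apply, LinearMap.id_apply, LinearMap.smul_apply,
      LinearMap.smulRight_apply, map_add, map_smul, smul_eq_mul, om_self]
    rw [om_swap x u]; ring

@[simp] lemma act_tv (u : Lat g) (c : ℤ) (x : Lat g) : act (tv u c) x = x + (c * om u x) • u := by
  simp [tv, mul_smul]

/-- The Eichler transformation `x ↦ x + ω(u,x) v + ω(v,x) u` attached to orthogonal vectors. -/
def ei (u v : Lat g) (h : om u v = 0) : SpZ g :=
  mkSp (LinearMap.id + (om u).smulRight v + (om v).smulRight u) fun x y => by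
    have h' : om v u = 0 := by rw [om_swap, h, neg_zero]
    simp only [LinearMap.add_apply, LinearMap.id_apply, LinearMap.smul_apply,
      LinearMap.smulRight_apply, map_add, map_smul, smul_eq_mul, om_self, h, h']
    rw [om_swap x u, om_swap x v]; ring

@[simp] lemma act_ei (u v : Lat g) (h) (x : Lat g) :
    act (ei u v h) x = x + om u x • v + om v x • u := by
  simp [ei]

lemma om_eq_zero_swap {u v : Lat g} (h : om u v = 0) : om v u = 0 := by
  rw [om_swap, h, neg_zero]

lemma tv_mul (u : Lat g) (c c' : ℤ) : tv u c * tv u c' = tv u (c + c') := by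
  refine sp_ext fun x => ?_
  simp only [act_mul_apply, act_tv, map_add, map_smul, om_self]
  module

lemma tv_zero (u : Lat g) : tv u 0 = 1 := sp_ext fun x => by simp

lemma tv_inv (u : Lat g) (c : ℤ) : (tv u c)⁻¹ = tv u (-c) := by
  rw [inv_eq_iff_mul_eq_one, tv_mul, add_neg_cancel, tv_zero]

lemma tv_zpow (u : Lat g) (c n : ℤ) : tv u c ^ n = tv u (n * c) := by
  have hn : ∀ n : ℕ, tv u c ^ n = tv u (n * c) := by
    intro n
    induction n with
    | zero => simp [tv_zero]
    | succ n ih => rw [pow_succ, ih, tv_mul]; congr 1; push_cast; ring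
  obtain ⟨n, rfl | rfl⟩ := n.eq_nat_or_neg
  · rw [zpow_natCast, hn]
  · rw [_root_.zpow_neg, zpow_natCast, hn, tv_inv]; congr 1; ring

lemma tv_conj (γ : SpZ g) (u : Lat g) (c : ℤ) : γ * tv u c * γ⁻¹ = tv (act γ u) c := by
  refine sp_ext fun x => ?_
  have : om (act γ u) x = om u (act γ⁻¹ x) := by
    rw [← om_act γ u, act_act_inv]
  simp only [act_mul_apply, act_tv, map_add, map_smul, act_act_inv, this]

lemma ei_conj (γ : SpZ g) (u v : Lat g) (h) :
    γ * ei u v h * γ⁻¹ = ei (act γ u) (act γ v) (by rw [om_act, h]) := by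
  refine sp_ext fun x => ?_
  have this (w : Lat g) : om (act γ w) x = om w (act γ⁻¹ x) := by
    rw [← om_act γ w, act_act_inv]
  simp only [act_mul_apply, act_ei, map_add, map_smul, act_act_inv, this]

lemma ei_mul (u v v' : Lat g) (h : om u v = 0) (h' : om u v' = 0) :
    ei u v h * ei u v' h' = tv u (om v v') * ei u (v + v') (by rw [map_add, h, h', add_zero]) := by
  refine sp_ext fun x => ?_
  simp only [act_mul_apply, act_tv, act_ei, map_add, map_smul, om_self, h, h',
    om_eq_zero_swap h, LinearMap.add_apply]
  module

lemma ei_eq_tv (u v : Lat g) (h : om u v = 0) :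
    ei u v h = tv (u + v) 1 * tv u (-1) * tv v (-1) := by
  refine sp_ext fun x => ?_
  simp only [act_mul_apply, act_tv, act_ei, map_add, map_smul, om_self, h,
    om_eq_zero_swap h, LinearMap.add_apply]
  module

lemma ei_inv (u v : Lat g) (h : om u v = 0) :
    (ei u v h)⁻¹ = ei u (-v) (by rw [map_neg, h, neg_zero]) := by
  rw [inv_eq_iff_mul_eq_one, ei_mul]
  refine sp_ext fun x => ?_
  simp

instance (d : ℕ) : (Gamma g d).Normal where
  conj_mem n hn γ := by
    change modred g d _ = 1
    have hn : modred g d (n : Matrix (Idx g) (Idx g) ℤ) = 1 := hn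
    rw [Submonoid.coe_mul, Submonoid.coe_mul, map_mul, map_mul, hn, mul_one, ← map_mul,
      ← Submonoid.coe_mul, mul_inv_cancel, Submonoid.coe_one, map_one]

lemma mem_Gamma_iff_basis {d : ℕ} {M : SpZ g} : M ∈ Gamma g d ↔
    (∀ k, ∃ u : Lat g, act M (ee k) = ee k + (d : ℤ) • u) ∧
      (∀ k, ∃ u : Lat g, act M (ff k) = ff k + (d : ℤ) • u) := by
  rw [mem_Gamma_iff]
  constructor
  · intro h
    choose u hu using h
    refine ⟨fun k => ⟨fun i => u i (Sum.inl k), funext fun i => ?_⟩,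
      fun k => ⟨fun i => u i (Sum.inr k), funext fun i => ?_⟩⟩
    · have := hu i (Sum.inl k)
      rw [act_ee]
      simp only [Pi.add_apply, Pi.smul_apply, smul_eq_mul, ee, Pi.single_apply]
      rw [Matrix.one_apply] at this
      linarith
    · have := hu i (Sum.inr k)
      rw [act_ff]
      simp only [Pi.add_apply, Pi.smul_apply, smul_eq_mul, ff, Pi.single_apply]
      rw [Matrix.one_apply] at this
      linarith
  · rintro ⟨he, hf⟩ i (k | k)
    · obtain ⟨u, hu⟩ := he k
      rw [← act_ee, hu]
      refine ⟨u i, ?_⟩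
      simp [ee, Pi.single_apply, Matrix.one_apply]
    · obtain ⟨u, hu⟩ := hf k
      rw [← act_ff, hu]
      refine ⟨u i, ?_⟩
      simp [ff, Pi.single_apply, Matrix.one_apply]

lemma mem_Gamma_of_forall {d : ℕ} {M : SpZ g}
    (h : ∀ x, ∃ u : Lat g, act M x = x + (d : ℤ) • u) : M ∈ Gamma g d :=
  mem_Gamma_iff_basis.mpr ⟨fun _ => h _, fun _ => h _⟩

lemma tv_mem_Gamma {d : ℕ} {u : Lat g} {c : ℤ} (h : (d : ℤ) ∣ c) : tv u c ∈ Gamma g d := by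
  obtain ⟨c, rfl⟩ := h
  exact mem_Gamma_of_forall fun x => ⟨(c * om u x) • u, by rw [act_tv, smul_smul]; ring_nf⟩

lemma ei_mem_Gamma {d : ℕ} {u v : Lat g} (h) : ei u ((d : ℤ) • v) h ∈ Gamma g d :=
  mem_Gamma_of_forall fun x => ⟨om u x • v + om v x • u, by
    rw [act_ei, map_smul, LinearMap.smul_apply]; module⟩

/-- The subgroup `W` contains the elementary symplectic matrices of level `r`. -/
structure ElemIn (r : ℕ) (W : Subgroup (SpZ g)) : Prop where
  tv_ee : ∀ k (c : ℤ), (r : ℤ) ∣ c → tv (ee k) c ∈ W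
  tv_ff : ∀ k (c : ℤ), (r : ℤ) ∣ c → tv (ff k) c ∈ W
  ei_ee : ∀ k (u : Lat g) (h : om (ee k) ((r : ℤ) • u) = 0), ei (ee k) ((r : ℤ) • u) h ∈ W
  ei_ff : ∀ k (u : Lat g) (h : om (ff k) ((r : ℤ) • u) = 0), ei (ff k) ((r : ℤ) • u) h ∈ W

lemma act_inr_of_fix {M : SpZ g} {i : Fin g} (h : act M (ee i) = ee i) (x : Lat g) :
    act M x (Sum.inr i) = x (Sum.inr i) := by
  rw [← om_ee_left i (act M x), ← om_ee_left i x, ← om_act M (ee i) x, h]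

lemma act_inl_of_fix {M : SpZ g} {i : Fin g} (h : act M (ff i) = ff i) (x : Lat g) :
    act M x (Sum.inl i) = x (Sum.inl i) := by
  rw [← neg_inj, ← om_ff_left i (act M x), ← om_ff_left i x, ← om_act M (ff i) x, h]

lemma ee_inl_ne {k i : Fin g} (h : i ≠ k) : ee k (Sum.inl i) = 0 := by simp [ee_inl, h]

lemma ff_inr_ne {k i : Fin g} (h : i ≠ k) : ff k (Sum.inr i) = 0 := by simp [ff_inr, h]

@[simp] lemma ee_inl_self (k : Fin g) : ee k (Sum.inl k) = 1 := by simp [ee_inl]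

@[simp] lemma ff_inr_self (k : Fin g) : ff k (Sum.inr k) = 1 := by simp [ff_inr]

section Reduction

variable {r : ℕ} {W : Subgroup (SpZ g)}

lemma mem_of_fix_ee_of_fix_ff (hW : ElemIn r W) (hr : r ≠ 0) (S : Finset (Fin g)) :
    ∀ M ∈ Gamma g r, (∀ i, act M (ee i) = ee i) → (∀ i ∉ S, act M (ff i) = ff i) → M ∈ W := by
  have hr' : (r : ℤ) ≠ 0 := by exact_mod_cast hr
  induction S using Finset.induction_on with
  | empty =>
    intro M _ he hf
    have : M = 1 := sp_ext_basis (by simpa using he) (by simpa using hf)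
    rw [this]; exact one_mem _
  | insert k S hk ih =>
    intro M hM he hf
    obtain ⟨u, hu⟩ := (mem_Gamma_iff_basis.mp hM).2 k
    have hinr : ∀ i, u (Sum.inr i) = 0 := by
      intro i
      have := act_inr_of_fix (he i) (ff k)
      simpa [hu, hr] using this
    have hinl : ∀ i, i ∉ S → i ≠ k → u (Sum.inl i) = 0 := by
      intro i hi hik
      have := act_inl_of_fix (hf i (by simp [hi, hik])) (ff k)
      simpa [hu, hr] using this
    have ho : om (ee k) ((r : ℤ) • u) = 0 := by simp [hinr]
    set N := tv (ee k) (-(r * u (Sum.inl k))) * ei (ee k) ((r : ℤ) • u) ho with hN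
    have hNW : N ∈ W := mul_mem (hW.tv_ee _ _ (by simp)) (hW.ei_ee _ _ _)
    have hNG : N ∈ Gamma g r := mul_mem (tv_mem_Gamma (by simp)) (ei_mem_Gamma _)
    have hNe : ∀ i, act N (ee i) = ee i := by
      intro i
      simp [hN, hinr]
    have hNk : act N (ff k) = act M (ff k) := by
      rw [hu]
      simp only [hN, act_mul_apply, act_ei, om_ff_right, act_tv, om_ee_left, map_add, map_smul,
        ee_inl_self, smul_eq_mul, hinr, ee_inr,
        LinearMap.smul_apply]
      module
    have hNf : ∀ i, i ∉ S → i ≠ k → act N (ff i) = ff i := by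
      intro i hi hik
      simp [hN, hinl i hi hik, ee_inl_ne hik]
    have : N⁻¹ * M ∈ W := by
      refine ih _ (mul_mem (inv_mem hNG) hM) (fun i => ?_) (fun i hi => ?_)
      · rw [act_mul_apply, he, act_inv_eq (hNe i)]
      · rw [act_mul_apply]
        by_cases hik : i = k
        · subst hik; exact act_inv_eq hNk
        · rw [hf i (by simp [hi, hik]), act_inv_eq (hNf i hi hik)]
    simpa using mul_mem hNW this

lemma mem_of_fix_ee (hW : ElemIn r W) (hr : r ≠ 0) {M : SpZ g} (hM : M ∈ Gamma g r)
    (he : ∀ i, act M (ee i) = ee i) : M ∈ W :=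
  mem_of_fix_ee_of_fix_ff hW hr Finset.univ M hM he fun i hi => absurd (Finset.mem_univ i) hi

/-- Moving `e_k + r u` to `e_k` when `u` has no component along `e_k`. -/
lemma exists_move_of_inl_eq_zero (hW : ElemIn r W) {I : Set (Fin g)} {k : Fin g}
    (hk : k ∉ I) {u : Lat g} (hu : u (Sum.inl k) = 0) (hI : ∀ i ∈ I, u (Sum.inr i) = 0) :
    ∃ w ∈ W, w ∈ Gamma g r ∧ (∀ i ∈ I, act w (ee i) = ee i) ∧
      act w (ee k + (r : ℤ) • u) = ee k := by
  have ho : om (ff k) ((r : ℤ) • (-u)) = 0 := by simp [hu]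
  set w := tv (ff k) (r * u (Sum.inr k)) * ei (ff k) ((r : ℤ) • (-u)) ho with hw
  have hwk : act w (ee k) = ee k + (r : ℤ) • u := by
    simp only [hw, act_mul_apply, act_ei, om_ff_left, om_ee_right, act_tv, map_add, map_smul,
      ff_inr_self, ff_inl, smul_eq_mul, hu, map_neg,
      LinearMap.smul_apply, LinearMap.neg_apply]
    module
  refine ⟨w⁻¹, inv_mem (mul_mem (hW.tv_ff _ _ (by simp)) (hW.ei_ff _ _ _)),
    inv_mem (mul_mem (tv_mem_Gamma (by simp)) (ei_mem_Gamma _)), fun i hi => act_inv_eq ?_,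
    act_inv_eq hwk⟩
  have hik : k ≠ i := fun h => hk (h ▸ hi)
  simp [hw, ff_inr_ne hik.symm, hI i hi]

/-- Moving `e_k + r u` to `e_k` when the relevant coordinates of `u` generate the unit ideal. -/
lemma exists_move_of_unimodular (hW : ElemIn r W) (hN : W.Normal) (hr : r ≠ 0) {I : Set (Fin g)}
    {k : Fin g} (hk : k ∉ I) {u z : Lat g} (hI : ∀ i ∈ I, u (Sum.inr i) = 0)
    (hzk : z (Sum.inr k) = 0) (hzI : ∀ i ∈ I, z (Sum.inr i) = 0) (hz : om z u = 1) :
    ∃ w ∈ W, w ∈ Gamma g r ∧ (∀ i ∈ I, act w (ee i) = ee i) ∧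
      act w (ee k + (r : ℤ) • u) = ee k := by
  have hr' : (r : ℤ) ≠ 0 := by exact_mod_cast hr
  set a := u (Sum.inl k) with ha
  set z' : Lat g := (-a) • (z - z (Sum.inl k) • ee k) with hz'
  have ho : om (ee k) z' = 0 := by simp [hz', hzk]
  set h := tv (ee k) (-a * z (Sum.inl k)) * ei (ee k) z' ho with hh
  have hhk : act h (ee k) = ee k := by simp [hh, hz', hzk]
  have hhI : ∀ i ∈ I, act h (ee i) = ee i := by
    intro i hi
    simp [hh, hz', hzI i hi]
  have h0 : act h u (Sum.inl k) = 0 := by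
    simp only [hh, hz', act_mul_apply, act_ei, om_ee_left, act_tv, map_add, map_smul, map_sub,
      Pi.add_apply, Pi.smul_apply, Pi.sub_apply, LinearMap.smul_apply, LinearMap.sub_apply, hz,
      smul_eq_mul, ee_inl_self, ee_inr, hzk]
    rw [← ha]; ring
  have hI' : ∀ i ∈ I, act h u (Sum.inr i) = 0 := fun i hi => by
    rw [act_inr_of_fix (hhI i hi), hI i hi]
  obtain ⟨w, hw, hwG, hwI, hwk⟩ := exists_move_of_inl_eq_zero hW hk h0 hI'
  refine ⟨h⁻¹ * w * h, by simpa using hN.conj_mem w hw h⁻¹, ?_, fun i hi => ?_, ?_⟩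
  · simpa using (inferInstance : (Gamma g r).Normal).conj_mem w hwG h⁻¹
  · rw [act_mul_apply, act_mul_apply, hhI i hi, hwI i hi, act_inv_eq (hhI i hi)]
  · rw [act_mul_apply, act_mul_apply, map_add, hhk, map_smul, hwk, act_inv_eq hhk]

lemma exists_isCoprime_add_mul {u A D : ℤ} (hD : D ≠ 0)
    (h : ∀ p : ℤ, Prime p → p ∣ u → p ∣ A → p ∣ D → False) : ∃ t, IsCoprime (u - t * A) D := by
  classical
  set S : Finset ℕ := D.natAbs.primeFactors.filter fun p : ℕ => ¬ (p : ℤ) ∣ u with hS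
  refine ⟨∏ p ∈ S, (p : ℤ), isCoprime_of_prime_dvd (fun h => hD h.2) fun q hq hq1 hq2 => ?_⟩
  have hqn : q.natAbs.Prime := Int.prime_iff_natAbs_prime.mp hq
  have hqd : ∀ x : ℤ, (q.natAbs : ℤ) ∣ x ↔ q ∣ x := fun x => Int.natAbs_dvd
  by_cases hqu : q ∣ u
  · have h1 : q ∣ (∏ p ∈ S, (p : ℤ)) * A := (dvd_sub_right hqu).mp hq1
    rcases hq.dvd_or_dvd h1 with h2 | h2
    · obtain ⟨p, hp, hqp⟩ := (Prime.dvd_finsetProd_iff hq _).mp h2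
      rw [hS, Finset.mem_filter, Nat.mem_primeFactors] at hp
      have : q.natAbs = p := by
        exact (Nat.prime_dvd_prime_iff_eq hqn hp.1.1).mp
          (Int.natCast_dvd_natCast.mp ((hqd _).mpr hqp))
      exact hp.2 (this ▸ (hqd u).mpr hqu)
    · exact h q hq hqu h2 hq2
  · have hmem : q.natAbs ∈ S := by
      rw [hS, Finset.mem_filter, Nat.mem_primeFactors]
      exact ⟨⟨hqn, Int.natAbs_dvd_natAbs.mpr hq2, Int.natAbs_ne_zero.mpr hD⟩,
        fun h => hqu ((hqd u).mp h)⟩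
    have h1 : q ∣ ∏ p ∈ S, (p : ℤ) :=
      (hqd _).mp (Finset.dvd_prod_of_mem (fun p : ℕ => (p : ℤ)) hmem)
    exact hqu ((dvd_sub_left (h1.mul_right A)).mp hq1)

lemma exists_move_of_inr_ne_zero (hW : ElemIn r W) (hN : W.Normal) (hr : r ≠ 0)
    {I : Set (Fin g)} {k j : Fin g} (hk : k ∉ I) (hj : j ∉ I) (hjk : j ≠ k) {u y : Lat g}
    (hI : ∀ i ∈ I, u (Sum.inr i) = 0) (hyI : ∀ i ∈ I, y (Sum.inr i) = 0)
    (hy : om (ee k + (r : ℤ) • u) y = 1) (huj : u (Sum.inr j) ≠ 0) :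
    ∃ w ∈ W, w ∈ Gamma g r ∧ (∀ i ∈ I, act w (ee i) = ee i) ∧
      act w (ee k + (r : ℤ) • u) = ee k := by
  set y0 : Lat g := y - y (Sum.inl k) • ee k - y (Sum.inr k) • ff k - y (Sum.inl j) • ee j
    - y (Sum.inr j) • ff j with hy0
  set A := 1 + r * u (Sum.inl k) with hA
  set s := - u (Sum.inr k) * y (Sum.inl k) - u (Sum.inr j) * y (Sum.inl j) + om u y0 with hs
  have hid : A * y (Sum.inr k) + r * (u (Sum.inl j) * y (Sum.inr j)) + r * s = 1 := by
    rw [hA, hs, hy0]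
    simp only [map_add, map_smul, map_sub, LinearMap.add_apply, LinearMap.smul_apply,
      om_ee_left, om_ee_right, om_ff_right, smul_eq_mul] at hy ⊢
    linear_combination hy
  have hD : (Int.gcd s (u (Sum.inr j)) : ℤ) ≠ 0 := by
    intro h
    rw [Nat.cast_eq_zero, Int.gcd_eq_zero_iff] at h
    exact huj h.2
  obtain ⟨t, ht⟩ := exists_isCoprime_add_mul (u := u (Sum.inl j)) (A := A) hD (by
    intro p hp h1 h2 h3
    have h4 : p ∣ s := h3.trans (Int.gcd_dvd_left ..)
    refine hp.not_dvd_one (hid ▸ ?_)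
    exact dvd_add (dvd_add (h2.mul_right _) ((h1.mul_right _).mul_left _)) (h4.mul_left _))
  obtain ⟨α, β', hαβ⟩ := ht
  obtain ⟨β, γ, hβγ⟩ : ∃ β γ : ℤ, β' * (Int.gcd s (u (Sum.inr j)) : ℤ) =
      β * s + γ * u (Sum.inr j) := by
    refine ⟨β' * Int.gcdA s (u (Sum.inr j)), β' * Int.gcdB s (u (Sum.inr j)), ?_⟩
    rw [Int.gcd_eq_gcd_ab]; ring
  rw [hβγ] at hαβ
  have ho : om (ff k) ((r : ℤ) • (t • ee j)) = 0 := by simp [ee_inl_ne hjk.symm]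
  set T := ei (ff k) ((r : ℤ) • (t • ee j)) ho with hT
  have hTI : ∀ i ∈ I, act T (ee i) = ee i := by
    intro i hi
    have hik : k ≠ i := fun h => hk (h ▸ hi)
    simp [hT, ff_inr_ne hik.symm]
  set u' : Lat g := u - (t * A) • ee j + (t * r * u (Sum.inr j)) • ff k with hu'
  have hTv : act T (ee k + (r : ℤ) • u) = ee k + (r : ℤ) • u' := by
    simp only [hT, act_ei, map_add, map_smul, om_ff_left, om_ee_left, ee_inr,
      smul_eq_mul, ee_inl_self, LinearMap.smul_apply, hu', hA]
    module
  set z : Lat g := (-α) • ff j + β • ((-y (Sum.inl k)) • (ee k - (t * r) • ee j)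
    - y (Sum.inl j) • ee j - y0) + γ • ee j with hz
  have hkj := hjk.symm
  obtain ⟨w, hw, hwG, hwI, hwk⟩ := exists_move_of_unimodular hW hN hr hk (u := u') (z := z)
    (by
      intro i hi
      have hik : i ≠ k := fun h => hk (h ▸ hi)
      simp [hu', hI i hi, ff_inr_ne hik])
    (by simp [hz, hy0, ff_inr_ne hkj])
    (by
      intro i hi
      have hik : i ≠ k := fun h => hk (h ▸ hi)
      have hij : i ≠ j := fun h => hj (h ▸ hi)
      simp [hz, hy0, ff_inr_ne hik, ff_inr_ne hij, hyI i hi])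
    (by
      have e1 : om y0 u' = - om u y0 := by
        rw [hu', map_add, map_sub, om_swap y0 u]
        simp [-zsmul_eq_mul, hy0, ee_inl_ne hkj, ff_inr_ne hjk]
      rw [hz]
      simp only [map_add, map_smul, map_sub, LinearMap.add_apply, LinearMap.smul_apply,
        LinearMap.sub_apply, om_ff_left, om_ee_left, e1, smul_eq_mul]
      simp only [hu', Pi.add_apply, Pi.sub_apply, Pi.smul_apply, smul_eq_mul, ee_inl_self,
        ff_inl, ee_inr, ff_inr_self, ff_inr_ne hjk]
      rw [hs] at hαβ
      linear_combination hαβ)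
  refine ⟨w * T, mul_mem hw (hW.ei_ff _ _ _), mul_mem hwG (ei_mem_Gamma _), fun i hi => ?_, ?_⟩
  · rw [act_mul_apply, hTI i hi, hwI i hi]
  · rw [act_mul_apply, hTv, hwk]

lemma exists_move (hW : ElemIn r W) (hN : W.Normal) (hr : 2 ≤ r)
    {I : Set (Fin g)} {k j : Fin g} (hk : k ∉ I) (hj : j ∉ I) (hjk : j ≠ k) {u y : Lat g}
    (hI : ∀ i ∈ I, u (Sum.inr i) = 0) (hyI : ∀ i ∈ I, y (Sum.inr i) = 0)
    (hy : om (ee k + (r : ℤ) • u) y = 1) :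
    ∃ w ∈ W, w ∈ Gamma g r ∧ (∀ i ∈ I, act w (ee i) = ee i) ∧
      act w (ee k + (r : ℤ) • u) = ee k := by
  by_cases huj : u (Sum.inr j) = 0
  swap
  · exact exists_move_of_inr_ne_zero hW hN (by omega) hk hj hjk hI hyI hy huj
  have ho : om (ff k) ((r : ℤ) • ff j) = 0 := by simp
  set T := ei (ff k) ((r : ℤ) • ff j) ho with hT
  have hTI : ∀ i ∈ I, act T (ee i) = ee i := by
    intro i hi
    have hik : k ≠ i := fun h => hk (h ▸ hi)
    have hij : j ≠ i := fun h => hj (h ▸ hi)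
    simp [hT, ff_inr_ne hik.symm, ff_inr_ne hij.symm]
  set A := 1 + r * u (Sum.inl k) with hA
  set u' : Lat g := u - A • ff j - (r * u (Sum.inl j)) • ff k with hu'
  have hTv : act T (ee k + (r : ℤ) • u) = ee k + (r : ℤ) • u' := by
    simp only [hT, act_ei, map_add, map_smul, om_ff_left, smul_eq_mul, ee_inl_self, LinearMap.smul_apply, hu', hA,
      ee_inl_ne hjk]
    module
  have hA0 : A ≠ 0 := by
    intro h
    have : (r : ℤ) ∣ 1 := ⟨-u (Sum.inl k), by rw [hA] at h; linarith⟩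
    have := Int.le_of_dvd one_pos this
    omega
  obtain ⟨w, hw, hwG, hwI, hwk⟩ := exists_move_of_inr_ne_zero hW hN (by omega) hk hj hjk
    (u := u') (y := act T y)
    (by
      intro i hi
      have hik : i ≠ k := fun h => hk (h ▸ hi)
      have hij : i ≠ j := fun h => hj (h ▸ hi)
      simp [hu', hI i hi, ff_inr_ne hik, ff_inr_ne hij])
    (fun i hi => by rw [act_inr_of_fix (hTI i hi), hyI i hi])
    (by rw [← hTv, om_act, hy])
    (by simpa [hu', huj, ff_inr_ne hjk] using hA0)
  refine ⟨w * T, mul_mem hw (hW.ei_ff _ _ _), mul_mem hwG (ei_mem_Gamma _), fun i hi => ?_, ?_⟩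
  · rw [act_mul_apply, hTI i hi, hwI i hi]
  · rw [act_mul_apply, hTv, hwk]

lemma exists_mul_fix (hW : ElemIn r W) (hN : W.Normal) (hr : 2 ≤ r)
    {I : Set (Fin g)} {k j : Fin g} (hk : k ∉ I) (hj : j ∉ I) (hjk : j ≠ k) {M : SpZ g}
    (hM : M ∈ Gamma g r) (hMI : ∀ i ∈ I, act M (ee i) = ee i) :
    ∃ w ∈ W, w ∈ Gamma g r ∧ (∀ i ∈ I, act w (ee i) = ee i) ∧ act (w * M) (ee k) = ee k := by
  obtain ⟨u, hu⟩ := (mem_Gamma_iff_basis.mp hM).1 k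
  have hI : ∀ i ∈ I, u (Sum.inr i) = 0 := by
    intro i hi
    have := act_inr_of_fix (hMI i hi) (ee k)
    have hr0 : r ≠ 0 := by omega
    simpa [hu, hr0] using this
  have hyI : ∀ i ∈ I, act M (ff k) (Sum.inr i) = 0 := by
    intro i hi
    have hik : i ≠ k := fun h => hk (h ▸ hi)
    rw [act_inr_of_fix (hMI i hi), ff_inr_ne hik]
  obtain ⟨w, hw, hwG, hwI, hwk⟩ := exists_move hW hN hr hk hj hjk hI hyI
    (by rw [← hu, om_act]; simp)
  exact ⟨w, hw, hwG, hwI, by rw [act_mul_apply, hu, hwk]⟩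

/-- Modulo `W`, every element of level `r` fixes all but one of the `e_i`. -/
lemma exists_mul_fix_ne (hW : ElemIn r W) (hN : W.Normal) (hr : 2 ≤ r) (j : Fin g) {M : SpZ g}
    (hM : M ∈ Gamma g r) :
    ∃ w ∈ W, w ∈ Gamma g r ∧ ∀ i, i ≠ j → act (w * M) (ee i) = ee i := by
  have key : ∀ S : Finset (Fin g), j ∉ S → ∃ w ∈ W, w ∈ Gamma g r ∧
      ∀ i ∈ S, act (w * M) (ee i) = ee i := by
    intro S
    induction S using Finset.induction_on with
    | empty => exact fun _ => ⟨1, one_mem _, one_mem _, by simp⟩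
    | insert k S hk ih =>
      intro hj
      rw [Finset.mem_insert, not_or] at hj
      obtain ⟨w, hw, hwG, hwS⟩ := ih hj.2
      obtain ⟨w', hw', hwG', hwS', hwk⟩ := exists_mul_fix hW hN hr (I := S) (by simpa using hk)
        (by simpa using hj.2) hj.1 (mul_mem hwG hM) (by simpa using hwS)
      refine ⟨w' * w, mul_mem hw' hw, mul_mem hwG' hwG, fun i hi => ?_⟩
      rw [mul_assoc]
      rcases Finset.mem_insert.mp hi with rfl | hi
      · exact hwk
      · rw [act_mul_apply, hwS i hi, hwS' i hi]
  obtain ⟨w, hw, hwG, h⟩ := key (Finset.univ.erase j) (by simp)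
  exact ⟨w, hw, hwG, fun i hi => h i (by simp [hi])⟩

end Reduction

section Central

variable {r : ℕ} {W : Subgroup (SpZ g)} [W.Normal]

/-- The elements that commute with `Γ[r]` modulo `W`. -/
def cz (r : ℕ) (W : Subgroup (SpZ g)) [W.Normal] : Subgroup (SpZ g) :=
  (Subgroup.centralizer (((Gamma g r).map (QuotientGroup.mk' W) : Subgroup (SpZ g ⧸ W)) :
    Set (SpZ g ⧸ W))).comap (QuotientGroup.mk' W)

lemma mem_cz {γ : SpZ g} : γ ∈ cz r W ↔
    ∀ M ∈ Gamma g r, (M : SpZ g ⧸ W) * γ = γ * M := by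
  rw [cz, Subgroup.mem_comap, Subgroup.mem_centralizer_iff]
  refine ⟨fun h M hM => h _ ⟨M, hM, rfl⟩, ?_⟩
  rintro h _ ⟨M, hM, rfl⟩
  exact h M hM

lemma mk_conj {γ M : SpZ g} (hγ : γ ∈ cz r W) (hM : M ∈ Gamma g r) :
    ((γ * M * γ⁻¹ : SpZ g) : SpZ g ⧸ W) = M := by
  rw [QuotientGroup.mk_mul, QuotientGroup.mk_mul, ← mem_cz.mp hγ M hM, QuotientGroup.mk_inv,
    mul_inv_cancel_right]

lemma conj_mem_cz {γ : SpZ g} (hγ : γ ∈ cz r W) (δ : SpZ g) : δ * γ * δ⁻¹ ∈ cz r W := by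
  have : ((Gamma g r).map (QuotientGroup.mk' W)).Normal :=
    Subgroup.Normal.map inferInstance _ (QuotientGroup.mk'_surjective W)
  have : (cz r W).Normal := by
    unfold cz; infer_instance
  exact this.conj_mem _ hγ _

lemma mk_eq_of_mul_mem {w M : SpZ g} (hw : w ∈ W) :
    ((w * M : SpZ g) : SpZ g ⧸ W) = M := by
  rw [QuotientGroup.mk_mul, (QuotientGroup.eq_one_iff w).mpr hw, one_mul]

lemma tv_ee_mem_cz (hW : ElemIn r W) (hr : 2 ≤ r) {k j : Fin g} (hjk : j ≠ k) :
    tv (ee k) 1 ∈ cz r W := by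
  refine mem_cz.mpr fun M hM => ?_
  obtain ⟨w, hw, -, -, hk⟩ := exists_mul_fix hW inferInstance hr (I := ∅) (by simp) (by simp) hjk
    hM (by simp)
  have := tv_conj (w * M) (ee k) 1
  rw [hk, mul_inv_eq_iff_eq_mul] at this
  have := congrArg (QuotientGroup.mk (s := W)) this
  rwa [QuotientGroup.mk_mul W (w * M), QuotientGroup.mk_mul W _ (w * M),
    mk_eq_of_mul_mem hw] at this

lemma tv_mem_cz_of_orbit (hW : ElemIn r W) (hr : 2 ≤ r) {k j : Fin g} (hjk : j ≠ k)
    (γ : SpZ g) (c : ℤ) : tv (act γ (ee k)) c ∈ cz r W := by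
  have := conj_mem_cz (tv_ee_mem_cz hW hr hjk) γ
  rw [tv_conj] at this
  simpa [tv_zpow] using zpow_mem this c

lemma tv_ff_mem_cz (hW : ElemIn r W) (hr : 2 ≤ r) {k j : Fin g} (hjk : j ≠ k) (c : ℤ) :
    tv (ff k) c ∈ cz r W := by
  have h : act (tv (ee k) (-1) * tv (ff k) (-1)) (ee k) = ff k := by simp
  simpa only [h] using tv_mem_cz_of_orbit hW hr hjk (tv (ee k) (-1) * tv (ff k) (-1)) c

lemma tv_smul (u : Lat g) (c d : ℤ) : tv (c • u) d = tv u (c * c * d) :=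
  sp_ext fun x => by
    simp only [act_tv, map_smul, LinearMap.smul_apply, smul_eq_mul]; module

lemma om_ee_smul_ff {k j : Fin g} (hjk : j ≠ k) (c : ℤ) : om (ee k) (c • ff j) = 0 := by
  simp [ff_inr_ne hjk.symm]

lemma ei_ee_ff_mem_cz (hW : ElemIn r W) (hr : 2 ≤ r) {k j : Fin g} (hjk : j ≠ k) (c : ℤ) :
    ei (ee k) (c • ff j) (om_ee_smul_ff hjk c) ∈ cz r W := by
  rw [ei_eq_tv]
  have ho : om (ff k) ((-c) • ff j) = 0 := by simp
  have h : act (ei (ff k) ((-c) • ff j) ho) (ee k) = ee k + c • ff j := by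
    simp [-zsmul_eq_mul, ff_inr_ne hjk.symm]
  refine mul_mem (mul_mem ?_ ?_) ?_
  · simpa only [h] using tv_mem_cz_of_orbit hW hr hjk (ei (ff k) ((-c) • ff j) ho) 1
  · simpa using tv_mem_cz_of_orbit hW hr hjk 1 (-1)
  · rw [tv_smul]; exact tv_ff_mem_cz hW hr hjk.symm _

end Central

/-- The embedding of `SL₂` acting on the hyperbolic plane spanned by `e_k` and `f_k`. -/
def iota (k : Fin g) (a b c d : ℤ) (h : a * d - b * c = 1) : SpZ g :=
  mkSp (LinearMap.id - (om (ff k)).smulRight ((a - 1) • ee k + c • ff k)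
    + (om (ee k)).smulRight (b • ee k + (d - 1) • ff k)) fun x y => by
    simp only [LinearMap.add_apply, LinearMap.sub_apply, LinearMap.id_apply, LinearMap.smul_apply,
      LinearMap.smulRight_apply, map_add, map_sub, map_smul, smul_eq_mul, om_ee_left, om_ee_right,
      om_ff_left, om_ff_right, ee_inl_self, ee_inr, ff_inr_self, ff_inl]
    linear_combination (x (Sum.inl k) * y (Sum.inr k) - x (Sum.inr k) * y (Sum.inl k)) * h

lemma act_iota (k : Fin g) (a b c d : ℤ) (h) (x : Lat g) : act (iota k a b c d h) x =
    x + x (Sum.inl k) • ((a - 1) • ee k + c • ff k)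
      + x (Sum.inr k) • (b • ee k + (d - 1) • ff k) := by
  simp only [iota, act_mkSp, LinearMap.add_apply, LinearMap.sub_apply, LinearMap.id_apply,
    LinearMap.smulRight_apply, om_ff_left, om_ee_left]
  module

/-- The embedding of `SL₂` acting on the isotropic planes spanned by `e_k, e_j` and `f_k, f_j`. -/
def levi {k j : Fin g} (hjk : j ≠ k) (p q s t : ℤ) (h : p * t - q * s = 1) : SpZ g :=
  mkSp (LinearMap.id - (om (ff k)).smulRight ((p - 1) • ee k + s • ee j)
    - (om (ff j)).smulRight (q • ee k + (t - 1) • ee j)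
    + (om (ee k)).smulRight ((t - 1) • ff k - q • ff j)
    + (om (ee j)).smulRight ((p - 1) • ff j - s • ff k)) fun x y => by
    simp only [LinearMap.add_apply, LinearMap.sub_apply, LinearMap.id_apply, LinearMap.smul_apply,
      LinearMap.smulRight_apply, map_add, map_sub, map_smul, smul_eq_mul, om_ee_left, om_ee_right,
      om_ff_left, om_ff_right, ee_inl_self, ee_inr, ff_inr_self, ff_inl, ee_inl_ne hjk,
      ff_inr_ne hjk, ee_inl_ne hjk.symm, ff_inr_ne hjk.symm]
    linear_combination (x (Sum.inl k) * y (Sum.inr k) - x (Sum.inr k) * y (Sum.inl k) +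
      x (Sum.inl j) * y (Sum.inr j) - x (Sum.inr j) * y (Sum.inl j)) * h

lemma act_levi {k j : Fin g} (hjk : j ≠ k) (p q s t : ℤ) (h) (x : Lat g) :
    act (levi hjk p q s t h) x = x + x (Sum.inl k) • ((p - 1) • ee k + s • ee j)
      + x (Sum.inl j) • (q • ee k + (t - 1) • ee j)
      + x (Sum.inr k) • ((t - 1) • ff k - q • ff j)
      + x (Sum.inr j) • ((p - 1) • ff j - s • ff k) := by
  simp only [levi, act_mkSp, LinearMap.add_apply, LinearMap.sub_apply, LinearMap.id_apply,
    LinearMap.smulRight_apply, om_ff_left, om_ee_left]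
  module

lemma iota_mem_Gamma {r : ℕ} (k : Fin g) {a b c d : ℤ} (h) (ha : (r : ℤ) ∣ a - 1)
    (hb : (r : ℤ) ∣ b) (hc : (r : ℤ) ∣ c) (hd : (r : ℤ) ∣ d - 1) :
    iota k a b c d h ∈ Gamma g r := by
  obtain ⟨a', ha⟩ := ha
  obtain ⟨b', hb⟩ := hb
  obtain ⟨c', hc⟩ := hc
  obtain ⟨d', hd⟩ := hd
  refine mem_Gamma_of_forall fun x => ⟨x (Sum.inl k) • (a' • ee k + c' • ff k)
    + x (Sum.inr k) • (b' • ee k + d' • ff k), ?_⟩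
  rw [act_iota, ha, hb, hc, hd]
  module

lemma levi_mem_Gamma {r : ℕ} {k j : Fin g} (hjk : j ≠ k) {p q s t : ℤ} (h)
    (hp : (r : ℤ) ∣ p - 1) (hq : (r : ℤ) ∣ q) (hs : (r : ℤ) ∣ s) (ht : (r : ℤ) ∣ t - 1) :
    levi hjk p q s t h ∈ Gamma g r := by
  obtain ⟨p', hp⟩ := hp
  obtain ⟨q', hq⟩ := hq
  obtain ⟨s', hs⟩ := hs
  obtain ⟨t', ht⟩ := ht
  refine mem_Gamma_of_forall fun x => ⟨x (Sum.inl k) • (p' • ee k + s' • ee j)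
      + x (Sum.inl j) • (q' • ee k + t' • ee j)
      + x (Sum.inr k) • (t' • ff k - q' • ff j)
      + x (Sum.inr j) • (p' • ff j - s' • ff k), ?_⟩
  rw [act_levi, hp, hq, hs, ht]
  module

section Mennicke

variable {r : ℕ} {W : Subgroup (SpZ g)}

/-- `M` has level `r`, fixes `e_i` for `i ≠ k`, and `M e_k` has coordinates `a`, `c` along
`e_k`, `f_k`. -/
structure Rep (r : ℕ) (k : Fin g) (a c : ℤ) (M : SpZ g) : Prop where
  mem : M ∈ Gamma g r
  fix : ∀ i, i ≠ k → act M (ee i) = ee i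
  inl : act M (ee k) (Sum.inl k) = a
  inr : act M (ee k) (Sum.inr k) = c

/-- The pairs occurring as first columns of matrices in `SL₂` of level `r`. -/
structure Col (r : ℕ) (a c : ℤ) : Prop where
  left : (r : ℤ) ∣ a - 1
  right : (r : ℤ) ∣ c
  cop : IsCoprime a c

lemma Rep.col {k : Fin g} {a c : ℤ} {M : SpZ g} (h : Rep r k a c M) : Col r a c := by
  have hm := mem_Gamma_iff.mp h.mem
  refine ⟨?_, ?_, ?_⟩
  · have := hm (Sum.inl k) (Sum.inl k)
    rwa [← act_ee, h.inl, Matrix.one_apply_eq] at this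
  · have := hm (Sum.inr k) (Sum.inl k)
    rwa [← act_ee, h.inr, Matrix.one_apply_ne (by simp), sub_zero] at this
  · have h1 := om_act M (ee k) (ff k)
    rw [om_apply, Finset.sum_eq_single k, h.inl, h.inr] at h1
    · refine ⟨act M (ff k) (Sum.inr k), - act M (ff k) (Sum.inl k), ?_⟩
      simp only [om_ee_left, ff_inr_self] at h1
      linear_combination h1
    · intro i _ hik
      rw [act_inr_of_fix (h.fix i hik), act_inr_of_fix (h.fix i hik)]
      simp [ff_inr_ne hik]
    · simp

lemma Col.exists_rep {a c : ℤ} (h : Col r a c) (k : Fin g) :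
    ∃ b d, ∃ hd : a * d - b * c = 1, iota k a b c d hd ∈ Gamma g r := by
  obtain ⟨d, b, hdb⟩ := h.cop
  have h1 : (r : ℤ) ∣ b * (1 - a) := (h.left.mul_left (-b)).trans ⟨1, by ring⟩
  have h2 : a * (d + b * c) - (-b + b * a) * c = 1 := by linear_combination hdb
  refine ⟨-b + b * a, d + b * c, h2, iota_mem_Gamma k h2 h.left ?_ h.right ?_⟩
  · exact (h.left.mul_left b).trans ⟨1, by ring⟩
  · obtain ⟨x, hx⟩ := h.left
    obtain ⟨y, hy⟩ := h.right
    refine ⟨b * y - d * x - b * y, ?_⟩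
    rw [eq_add_of_sub_eq hx] at hdb
    rw [hy] at hdb ⊢
    linear_combination hdb

lemma rep_iota {k : Fin g} {a b c d : ℤ} {h} (hm : iota k a b c d h ∈ Gamma g r) :
    Rep r k a c (iota k a b c d h) :=
  ⟨hm, fun i hi => by simp [act_iota, ee_inl_ne hi.symm], by simp [act_iota], by simp [act_iota]⟩

lemma Rep.inv_mul_mem (hW : ElemIn r W) (hr : r ≠ 0) {k : Fin g} {a c : ℤ}
    {M N : SpZ g} (hM : Rep r k a c M) (hN : Rep r k a c N) : M⁻¹ * N ∈ W := by
  obtain ⟨u, hu⟩ := (mem_Gamma_iff_basis.mp hM.mem).1 k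
  obtain ⟨v, hv⟩ := (mem_Gamma_iff_basis.mp hN.mem).1 k
  have hfix : ∀ i, i ≠ k → act (M⁻¹ * N) (ee i) = ee i := fun i hi => by
    rw [act_mul_apply, hN.fix i hi, act_inv_eq (hM.fix i hi)]
  have hw0 : ∀ i, (v - u) (Sum.inr i) = 0 := by
    intro i
    have h1 : act M (ee k) (Sum.inr i) = act N (ee k) (Sum.inr i) := by
      by_cases hi : i = k
      · subst hi; rw [hM.inr, hN.inr]
      · rw [act_inr_of_fix (hM.fix i hi), act_inr_of_fix (hN.fix i hi)]
    rw [hu, hv] at h1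
    simp [hr] at h1
    simp [h1]
  have hwk : (v - u) (Sum.inl k) = 0 := by
    have h1 : act M (ee k) (Sum.inl k) = act N (ee k) (Sum.inl k) := by
      rw [hM.inl, hN.inl]
    rw [hu, hv] at h1
    simp [hr] at h1
    simp [h1]
  have hwM : act M (v - u) = v - u := by
    have h1 : v - u = ∑ i, (v - u) (Sum.inl i) • ee i := by
      funext j
      rcases j with j | j
      · simp [Finset.sum_apply, ee_inl]
      · simp only [Finset.sum_apply, Pi.smul_apply, ee_inr, smul_zero, Finset.sum_const_zero]
        exact hw0 j
    rw [h1, map_sum]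
    refine Finset.sum_congr rfl fun i _ => ?_
    rw [map_smul]
    by_cases hi : i = k
    · subst hi; rw [hwk, zero_smul, zero_smul]
    · rw [hM.fix i hi]
  have hk : act (M⁻¹ * N) (ee k) = ee k + (r : ℤ) • (v - u) := by
    rw [act_mul_apply]
    refine act_inv_eq ?_
    rw [map_add, map_smul, hwM, hu, hv]
    module
  obtain ⟨w, hw, hwG, hwI, hwk⟩ := exists_move_of_inl_eq_zero hW (I := {i | i ≠ k}) (k := k)
    (by simp) hwk fun i _ => hw0 i
  have : w * (M⁻¹ * N) ∈ W := by
    refine mem_of_fix_ee hW hr (mul_mem hwG (mul_mem (inv_mem hM.mem) hN.mem)) fun i => ?_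
    rw [act_mul_apply]
    by_cases hi : i = k
    · subst hi; rw [hk, hwk]
    · rw [hfix i hi, hwI i hi]
  exact (Subgroup.mul_mem_cancel_left W hw).mp this

variable [W.Normal]

open Classical in
/-- The Mennicke symbol: the class modulo `W` of the elements with first column `(a, c)`. -/
noncomputable def sg (r : ℕ) (W : Subgroup (SpZ g)) [W.Normal] (k : Fin g) (a c : ℤ) :
    SpZ g ⧸ W :=
  if h : ∃ M, Rep r k a c M then (h.choose : SpZ g) else 1

lemma Rep.sg_eq (hW : ElemIn r W) (hr : r ≠ 0) {k : Fin g} {a c : ℤ} {M : SpZ g}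
    (h : Rep r k a c M) : sg r W k a c = M := by
  have hex : ∃ M, Rep r k a c M := ⟨M, h⟩
  rw [sg, dif_pos hex]
  exact QuotientGroup.eq.mpr (hex.choose_spec.inv_mul_mem hW hr h)

lemma Col.exists_sg (hW : ElemIn r W) (hr : r ≠ 0) {a c : ℤ} (h : Col r a c) (k : Fin g) :
    ∃ M, Rep r k a c M ∧ sg r W k a c = M := by
  obtain ⟨b, d, hd, hm⟩ := h.exists_rep k
  exact ⟨_, rep_iota hm, (rep_iota hm).sg_eq hW hr⟩

lemma sg_one (hW : ElemIn r W) (hr : r ≠ 0) (k : Fin g) : sg r W k 1 0 = 1 := by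
  have : Rep r k 1 0 (1 : SpZ g) := ⟨one_mem _, by simp, by simp, by simp⟩
  exact this.sg_eq hW hr

lemma sg_add_right (hW : ElemIn r W) (hr : r ≠ 0) {a c : ℤ} (h : Col r a c) (k : Fin g) (t : ℤ) :
    sg r W k a (c + r * t * a) = sg r W k a c := by
  obtain ⟨M, hM, hs⟩ := h.exists_sg hW hr k
  have ht : (r : ℤ) ∣ -(r * t) := by simp
  have : Rep r k a (c + r * t * a) (tv (ff k) (-(r * t)) * M) := by
    refine ⟨mul_mem (tv_mem_Gamma ht) hM.mem, fun i hi => ?_, ?_, ?_⟩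
    · rw [act_mul_apply, hM.fix i hi]; simp [ff_inr_ne hi]
    · simp [hM.inl]
    · simp [hM.inl, hM.inr]
  rw [this.sg_eq hW hr, hs, mk_eq_of_mul_mem (hW.tv_ff _ _ ht)]

lemma sg_add_left (hW : ElemIn r W) (hr : 2 ≤ r) {a c : ℤ} (h : Col r a c) {k j : Fin g}
    (hjk : j ≠ k) (t : ℤ) : sg r W k (a + t * c) c = sg r W k a c := by
  have hr0 : r ≠ 0 := by omega
  obtain ⟨M, hM, hs⟩ := h.exists_sg hW hr0 k
  have hU : tv (ee k) t ∈ cz r W := by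
    simpa using tv_mem_cz_of_orbit hW hr hjk 1 t
  have hUe : ∀ i, act (tv (ee k) t) (ee i) = ee i := by simp
  have : Rep r k (a + t * c) c (tv (ee k) t * M * (tv (ee k) t)⁻¹) := by
    refine ⟨(inferInstance : (Gamma g r).Normal).conj_mem _ hM.mem _, fun i hi => ?_, ?_, ?_⟩
    · simp only [act_mul_apply, act_inv_eq (hUe i), hM.fix i hi, hUe]
    · simp only [act_mul_apply, act_inv_eq (hUe k)]
      simp [hM.inl, hM.inr]
    · simp only [act_mul_apply, act_inv_eq (hUe k)]
      simp [hM.inr]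
  rw [this.sg_eq hW hr0, hs, mk_conj hU hM.mem]

end Mennicke

section Mennicke

variable {r : ℕ} {W : Subgroup (SpZ g)} [W.Normal]

lemma act_ei_ee_ff {k j : Fin g} (hjk : j ≠ k) (c : ℤ) (x : Lat g) :
    act (ei (ee k) (c • ff j) (om_ee_smul_ff hjk c)) x =
      x + (c * x (Sum.inr k)) • ff j - (c * x (Sum.inl j)) • ee k := by
  simp only [act_ei, om_ee_left, map_smul, LinearMap.smul_apply, om_ff_left, smul_eq_mul]
  module

lemma exists_mem_cz (hW : ElemIn r W) (hr : 2 ≤ r) {k j : Fin g} (hjk : j ≠ k) (s w : ℤ) :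
    ∃ κ ∈ cz r W, (∀ i, i ≠ k → i ≠ j → act κ (ee i) = ee i) ∧
      act κ (ee k) = s • ee k + ee j ∧ act κ (ee j) = (s * w - 1) • ee k + w • ee j ∧
      act κ (ff k) = w • ff k - (s * w - 1) • ff j := by
  have hkj := hjk.symm
  refine ⟨ei (ee k) ((-(s - 1)) • ff j) (om_ee_smul_ff hjk _) *
    ei (ee j) ((-1 : ℤ) • ff k) (om_ee_smul_ff hkj _) *
    ei (ee k) ((-(w - 1)) • ff j) (om_ee_smul_ff hjk _), mul_mem (mul_mem
      (ei_ee_ff_mem_cz hW hr hjk _) (ei_ee_ff_mem_cz hW hr hkj _))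
      (ei_ee_ff_mem_cz hW hr hjk _), fun i hik hij => ?_, ?_, ?_, ?_⟩
  · simp only [act_mul_apply, act_ei_ee_ff hjk, act_ei_ee_ff hkj, ee_inl_ne hij.symm, ee_inr]
    simp [ee_inl_ne hik.symm, ee_inl_ne hij.symm]
  all_goals
    simp only [act_mul_apply, act_ei_ee_ff hjk, act_ei_ee_ff hkj, ee_inr, ff_inl, ee_inl_ne hjk, ee_inl_ne hkj,
      ee_inl_self, ff_inr_self, ff_inr_ne hjk, ff_inr_ne hkj, Pi.add_apply, Pi.sub_apply,
      Pi.smul_apply, smul_eq_mul]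
    module

lemma sg_mul_sq (hW : ElemIn r W) (hr : 2 ≤ r) {k j : Fin g} (hjk : j ≠ k) {a s w z : ℤ}
    (hz : s * w - a * z = 1) (ha : (r : ℤ) ∣ a - 1) :
    ∃ φ : SpZ g ⧸ W, ∀ c, Col r a c →
      sg r W k a c = sg r W k a (c * w ^ 2) * φ := by
  have hr0 : r ≠ 0 := by omega
  have hkj := hjk.symm
  have hP : (1 + (a - 1) * z) * (1 - (a - 1) * (a * z)) - (-((a - 1) * (s * z))) * ((a - 1) * w)
      = 1 := by
    linear_combination (a - 1) ^ 2 * z * hz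
  set P : SpZ g := levi hjk _ _ _ _ hP with hPdef
  have hPG : P ∈ Gamma g r := by
    refine levi_mem_Gamma hjk _ ?_ ?_ ?_ ?_
    · rw [add_sub_cancel_left]; exact ha.mul_right _
    · exact (ha.mul_right _).neg_right
    · exact ha.mul_right _
    · rw [sub_sub_cancel_left]; exact (ha.mul_right _).neg_right
  refine ⟨P, fun c hc => ?_⟩
  have hc' : Col r a (c * w ^ 2) := by
    refine ⟨ha, hc.right.mul_right _, hc.cop.mul_right (IsCoprime.pow_right ⟨-z, s, ?_⟩)⟩
    linear_combination hz
  obtain ⟨b, d, hd, hM⟩ := hc.exists_rep (g := g) k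
  obtain ⟨b', d', hd', hM'⟩ := hc'.exists_rep (g := g) k
  obtain ⟨κ, hκ, hκi, hκk, hκj, hκf⟩ := exists_mem_cz hW hr hjk s w
  set M : SpZ g := iota k a b c d hd
  set M' : SpZ g := iota k a b' (c * w ^ 2) d' hd'
  obtain ⟨c₀, hc₀⟩ := hc.right
  have ho : om (ff k) ((r : ℤ) • ((c₀ * w * z) • ff j)) = 0 := by simp
  have hβ : (r : ℤ) ∣ -(c * a * z ^ 2) := ((hc.right.mul_right _).mul_right _).neg_right
  set L : SpZ g := ei (ff k) ((r : ℤ) • ((c₀ * w * z) • ff j)) ho * tv (ff j) (-(c * a * z ^ 2))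
    with hL
  have hLW : L ∈ W := mul_mem (hW.ei_ff _ _ _) (hW.tv_ff _ _ hβ)
  have hLG : L ∈ Gamma g r := mul_mem (ei_mem_Gamma _) (tv_mem_Gamma hβ)
  have hXG : L * (M' * P) ∈ Gamma g r := mul_mem hLG (mul_mem hM' hPG)
  have hPe : act P (s • ee k + ee j) = s • ee k + a • ee j := by
    simp only [hPdef, act_levi, Pi.add_apply, Pi.smul_apply, smul_eq_mul, ee_inr, ee_inl_self,
      ee_inl_ne hjk, ee_inl_ne hkj]
    match_scalars
    · ring
    · linear_combination (a - 1) * hz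
    · ring
    · ring
  have hPe' : act P ((s * w - 1) • ee k + w • ee j) = z • ee k + w • ee j := by
    simp only [hPdef, act_levi, Pi.add_apply, Pi.smul_apply, smul_eq_mul, ee_inr, ee_inl_self,
      ee_inl_ne hjk, ee_inl_ne hkj]
    match_scalars
    · linear_combination (1 + (a - 1) * z) * hz - (a - 1) * z * hz
    · linear_combination (a - 1) * w * hz
    · ring
    · ring
  have hM'e (x y : ℤ) : act M' (x • ee k + y • ee j) =
      (x * a) • ee k + (x * (c * w ^ 2)) • ff k + y • ee j := by
    simp only [M', act_iota, Pi.add_apply, Pi.smul_apply, smul_eq_mul, ee_inr, ee_inl_self,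
      ee_inl_ne hkj]
    module
  have hMk : act M (ee k) = a • ee k + c • ff k := by
    simp only [M, act_iota, ee_inr, ee_inl_self]
    module
  have hMj : act M (ee j) = ee j := by
    simp only [M, act_iota, ee_inr, ee_inl_ne hkj]
    module
  have hLk : act L (ee k) = ee k - (c * w * z) • ff j := by
    simp only [hL, act_mul_apply, act_ei, act_tv, om_ff_left, map_smul, map_add, LinearMap.smul_apply,
      smul_eq_mul, ff_inl, ee_inl_self, ee_inl_ne hjk, hc₀]
    module
  have hLj : act L (ee j) = ee j - (c * w * z) • ff k + (c * a * z ^ 2) • ff j := by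
    simp only [hL, act_mul_apply, act_ei, act_tv, om_ff_left, map_smul, map_add, LinearMap.smul_apply,
      smul_eq_mul, ff_inl, ee_inl_self, ee_inl_ne hkj, hc₀]
    module
  have hLf : act L (ff k) = ff k := by
    simp [hL]
  have hLi (i : Fin g) (hik : i ≠ k) (hij : i ≠ j) : act L (ee i) = ee i := by
    simp [hL, ff_inr_ne hij, ff_inr_ne hik]
  clear_value L
  have hfix : ∀ i, act (L * (M' * P) * κ) (ee i) = act (κ * M) (ee i) := by
    intro i
    by_cases hik : i = k
    · subst hik
      rw [act_mul_apply, act_mul_apply, act_mul_apply, hκk, hPe, hM'e, act_mul_apply, hMk]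
      simp only [map_add, map_smul, hκk, hκf, hLk, hLj, hLf]
      linear_combination (c * w * hz) • ff i + ((c - a * c * z) * hz) • ff j
    · by_cases hij : i = j
      · subst hij
        rw [act_mul_apply, act_mul_apply, act_mul_apply, hκj, hPe', hM'e, act_mul_apply, hMj, hκj]
        simp only [map_add, map_smul, hLk, hLj, hLf]
        linear_combination (-hz) • ee k
      · simp [M, M', hPdef, hLi i hik hij, hκi i hik hij, act_levi, act_iota, ee_inl_ne (Ne.symm hik),
          ee_inl_ne (Ne.symm hij)]
  have hNG : (L * (M' * P) * κ)⁻¹ * (κ * M) ∈ Gamma g r := by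
    have := (inferInstance : (Gamma g r).Normal).conj_mem _ (inv_mem hXG) κ⁻¹
    have := mul_mem this hM
    convert this using 1
    group
  have hNW := mem_of_fix_ee hW hr0 hNG fun i => by
    rw [act_mul_apply]; exact act_inv_eq (hfix i)
  have h1 := QuotientGroup.eq.mpr hNW
  rw [QuotientGroup.mk_mul, QuotientGroup.mk_mul W κ, ← mem_cz.mp hκ M hM, mul_left_inj,
    mk_eq_of_mul_mem hLW] at h1
  rw [(rep_iota hM).sg_eq hW hr0, (rep_iota hM').sg_eq hW hr0, ← h1, QuotientGroup.mk_mul]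

end Mennicke

section Mennicke

variable {r : ℕ} {W : Subgroup (SpZ g)} [W.Normal]

lemma Col.add_right {a c : ℤ} (h : Col r a c) (t : ℤ) : Col r a (c + r * t * a) :=
  ⟨h.left, dvd_add h.right ⟨t * a, by ring⟩, (IsCoprime.add_mul_right_right_iff).mpr h.cop⟩

lemma Col.of_mul {a x : ℤ} (h : (r : ℤ) ∣ a - 1) (hx : IsCoprime a x) : Col r a (r * x) := by
  refine ⟨h, dvd_mul_right _ _, IsCoprime.mul_right ?_ hx⟩
  obtain ⟨t, ht⟩ := h
  exact ⟨1, -t, by linear_combination ht⟩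

lemma sg_self (hW : ElemIn r W) (hr : 2 ≤ r) {k j : Fin g} (hjk : j ≠ k) {a ε : ℤ}
    (ha : (r : ℤ) ∣ a - 1) (hε : ε * ε = 1) : sg r W k a (r * ε) = 1 := by
  have hr0 : r ≠ 0 := by omega
  have hc : Col r a (r * ε) := Col.of_mul ha ⟨0, ε, by linear_combination hε⟩
  obtain ⟨t, ht⟩ := ha
  rw [← sg_add_left hW hr hc hjk (-(t * ε)),
    show a + -(t * ε) * (r * ε) = 1 by linear_combination ht - r * t * hε,
    show (r : ℤ) * ε = 0 + r * ε * 1 by ring,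
    sg_add_right hW hr0 ⟨by simp, by simp, isCoprime_one_left⟩, sg_one hW hr0]

lemma pow_eq_one_of_sg_mul_sq (hW : ElemIn r W) (hr : r ≠ 0) {k : Fin g} {a w : ℤ}
    (ha : (r : ℤ) ∣ a - 1) (hw : IsCoprime a w) {φ : SpZ g ⧸ W}
    (hφ : ∀ c, Col r a c → sg r W k a c = sg r W k a (c * w ^ 2) * φ) {n : ℕ}
    (hn : a ∣ w ^ (2 * n) - 1) : φ ^ n = 1 := by
  have hcol (m : ℕ) : Col r a (r * w ^ (2 * m)) := Col.of_mul ha hw.pow_right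
  have hit (m : ℕ) : sg r W k a (r * w ^ (2 * 0)) = sg r W k a (r * w ^ (2 * m)) * φ ^ m := by
    induction m with
    | zero => simp
    | succ m ih =>
      rw [ih, hφ _ (hcol m), pow_succ' φ, mul_assoc,
        show (r : ℤ) * w ^ (2 * m) * w ^ 2 = r * w ^ (2 * (m + 1)) by ring]
  obtain ⟨t, ht⟩ := hn
  have h1 := hit n
  rw [show (r : ℤ) * w ^ (2 * n) = r * w ^ (2 * 0) + r * t * a by linear_combination (r : ℤ) * ht,
    sg_add_right hW hr (hcol 0)] at h1
  exact mul_eq_left.mp h1.symm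

lemma exists_sq_eq_mul {p : ℕ} [Fact p.Prime] (hp : p % 4 = 3) {x : ℤ} (hx : (x : ZMod p) ≠ 0) :
    ∃ ε s : ℤ, ε * ε = 1 ∧ (p : ℤ) ∣ ε * s ^ 2 - x := by
  have hm : legendreSym p (-1) = -1 := by
    rw [legendreSym.eq_neg_one_iff]
    have := (ZMod.exists_sq_eq_neg_one_iff (p := p)).not
    simp only [ne_eq, not_not] at this
    simpa using this.mpr hp
  obtain ⟨ε, hε, hl⟩ : ∃ ε : ℤ, ε * ε = 1 ∧ legendreSym p (ε * x) = 1 := by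
    rcases legendreSym.eq_one_or_neg_one p hx with h | h
    · exact ⟨1, by norm_num, by simpa using h⟩
    · exact ⟨-1, by norm_num, by rw [legendreSym.mul, hm, h]; norm_num⟩
  have hεx : ((ε * x : ℤ) : ZMod p) ≠ 0 := by
    intro h0
    rw [(legendreSym.eq_zero_iff p _).mpr h0] at hl
    exact zero_ne_one hl
  obtain ⟨y, hy⟩ := (legendreSym.eq_one_iff p hεx).mp hl
  obtain ⟨s, rfl⟩ := ZMod.intCast_surjective y
  refine ⟨ε, s, hε, ?_⟩
  rw [← (ZMod.intCast_zmod_eq_zero_iff_dvd _ p)]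
  have : ((ε * ε : ℤ) : ZMod p) = 1 := by rw [hε]; simp
  push_cast at this hy ⊢
  linear_combination -ε * hy + x * this

lemma sg_neg_prime_pow (hW : ElemIn r W) (hr : 2 ≤ r) {k j : Fin g} (hjk : j ≠ k) {p : ℕ}
    (hp : p.Prime) (hp4 : p % 4 = 3) (hpr : (r : ℤ) ∣ -p - 1) {x : ℤ} (hx : ¬ (p : ℤ) ∣ x) :
    sg r W k (-p) (r * x) ^ ((p - 1) / 2) = 1 := by
  have hr0 : r ≠ 0 := by omega
  have : Fact p.Prime := ⟨hp⟩
  obtain ⟨ε, s, hε, t, ht⟩ := exists_sq_eq_mul hp4 (x := x) fun h0 =>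
    hx ((ZMod.intCast_zmod_eq_zero_iff_dvd _ p).mp h0)
  have hps : ¬ (p : ℤ) ∣ s := fun h => hx <| by
    have h2 : (p : ℤ) ∣ ε * s ^ 2 := (dvd_pow h two_ne_zero).mul_left ε
    rw [show x = ε * s ^ 2 - p * t by linear_combination -ht]
    exact dvd_sub h2 (dvd_mul_right _ _)
  have hcop : IsCoprime (p : ℤ) s :=
    (Nat.prime_iff_prime_int.mp hp).coprime_iff_not_dvd.mpr hps
  obtain ⟨z, u, hz⟩ := hcop
  obtain ⟨φ, hφ⟩ := sg_mul_sq (W := W) hW hr hjk (a := -p) (s := u) (w := s) (z := z)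
    (by linear_combination hz) hpr
  have hn : φ ^ ((p - 1) / 2) = 1 := by
    refine pow_eq_one_of_sg_mul_sq hW hr0 (w := s) hpr ⟨-z, u, by linear_combination hz⟩ hφ ?_
    rw [neg_dvd, ← ZMod.intCast_zmod_eq_zero_iff_dvd, show 2 * ((p - 1) / 2) = p - 1 by omega]
    push_cast
    rw [ZMod.pow_card_sub_one_eq_one, sub_self]
    exact fun h0 => hps ((ZMod.intCast_zmod_eq_zero_iff_dvd _ p).mp h0)
  have h1 := hφ (r * ε) (Col.of_mul hpr ⟨0, ε, by linear_combination hε⟩)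
  have hxc : IsCoprime (-p : ℤ) x :=
    ((Nat.prime_iff_prime_int.mp hp).coprime_iff_not_dvd.mpr hx).neg_left
  rw [sg_self hW hr hjk hpr hε,
    show (r : ℤ) * ε * s ^ 2 = r * x + r * (-t) * (-p) by linear_combination (r : ℤ) * ht,
    sg_add_right hW hr0 (Col.of_mul hpr hxc)] at h1
  rw [eq_inv_of_mul_eq_one_left h1.symm, inv_pow, hn, inv_one]

end Mennicke

section Mennicke

variable {r : ℕ} {W : Subgroup (SpZ g)} [W.Normal]

lemma exists_prime_dvd_add {a q : ℤ} (hq : q ≠ 0) (ha : IsCoprime a q) :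
    ∃ p : ℕ, p.Prime ∧ q.natAbs < p ∧ q ∣ p + a := by
  have : NeZero q.natAbs := ⟨by simpa using hq⟩
  have hu : IsUnit ((-a : ℤ) : ZMod q.natAbs) := by
    rw [← isCoprime_zero_right]
    have h1 : IsCoprime (-a) (q.natAbs : ℤ) := by
      rw [Int.isCoprime_iff_gcd_eq_one] at ha ⊢
      rwa [Int.neg_gcd, Int.gcd_eq_natAbs_gcd_natAbs, Int.natAbs_natCast,
        ← Int.gcd_eq_natAbs_gcd_natAbs]
    have h2 := h1.map (Int.castRingHom (ZMod q.natAbs))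
    rwa [eq_intCast, map_natCast, ZMod.natCast_self] at h2
  obtain ⟨p, hpq, hp, he⟩ := Nat.forall_exists_prime_gt_and_eq_mod hu q.natAbs
  refine ⟨p, hp, hpq, ?_⟩
  rw [← Int.natAbs_dvd, ← ZMod.intCast_zmod_eq_zero_iff_dvd]
  push_cast at he ⊢
  rw [he, neg_add_cancel]

lemma eq_one_of_pow_eq_one {G : Type*} [Group G] {σ : G} {m n : ℕ} (h : IsCoprime (m : ℤ) n)
    (hm : σ ^ m = 1) (hn : σ ^ n = 1) : σ = 1 := by
  rw [← orderOf_eq_one_iff, ← Nat.dvd_one, ← (Nat.isCoprime_iff_coprime.mp h)]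
  exact Nat.dvd_gcd (orderOf_dvd_of_pow_eq_one hm) (orderOf_dvd_of_pow_eq_one hn)

lemma sg_pow_of_prime (hW : ElemIn r W) (hr : 4 ∣ r) (hr0 : r ≠ 0) {k j : Fin g} (hjk : j ≠ k)
    {a x : ℤ} (h : Col r a (r * x)) (hx : x ≠ 0) {p : ℕ} (hp : p.Prime)
    (hpx : (r * x : ℤ).natAbs < p) (hpa : (r * x : ℤ) ∣ p + a) :
    sg r W k a (r * x) ^ ((p - 1) / 2) = 1 := by
  have hr2 : 2 ≤ r := by omega
  obtain ⟨t, ht⟩ := hpa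
  have h4 : (4 : ℤ) ∣ r := by exact_mod_cast hr
  obtain ⟨u, hu⟩ := h.left
  have hp4 : p % 4 = 3 := by
    obtain ⟨r', hr'⟩ := h4
    have : (p : ℤ) = 4 * (r' * (x * t - u)) - 1 := by
      rw [hr'] at ht hu
      linear_combination ht - hu
    omega
  rw [← sg_add_left hW hr2 h hjk (-t), show a + -t * (r * x) = -p by linear_combination ht]
  refine sg_neg_prime_pow hW hr2 hjk hp hp4 ⟨u - x * t, by linear_combination hu - ht⟩ fun hd => ?_
  have h1 := Int.natAbs_dvd_natAbs.mpr (hd.mul_left (r : ℤ))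
  rw [Int.natAbs_natCast] at h1
  have h2 := Nat.le_of_dvd (Int.natAbs_pos.mpr (mul_ne_zero (by exact_mod_cast hr0) hx)) h1
  omega

lemma Col.sg_eq_one (hW : ElemIn r W) (hr : 4 ∣ r) (hr0 : r ≠ 0) {k j : Fin g} (hjk : j ≠ k)
    {a c : ℤ} (h : Col r a c) : sg r W k a c = 1 := by
  have hr2 : 2 ≤ r := by omega
  obtain ⟨y, rfl⟩ := h.right
  obtain ⟨x, hx⟩ : ∃ x, x = y + a * (y - 1) := ⟨_, rfl⟩
  rw [← sg_add_right hW hr0 h k (y - 1),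
    show (r : ℤ) * y + r * (y - 1) * a = r * x by rw [hx]; ring]
  have hc : Col r a (r * x) := by
    have := h.add_right (y - 1)
    rwa [show (r : ℤ) * y + r * (y - 1) * a = r * x by rw [hx]; ring] at this
  have h4 : (4 : ℤ) ∣ r := by exact_mod_cast hr
  have hr0' : (r : ℤ) ≠ 0 := by exact_mod_cast hr0
  have ha4 : (4 : ℤ) ∣ a - 1 := h4.trans h.left
  have hx1 : x - (a + 1) * (y - 1) = 1 := by rw [hx]; ring
  have hx0 : x ≠ 0 := by
    rintro rfl
    have : IsUnit (a + 1) := .of_mul_eq_one (-(y - 1)) (by linear_combination hx1)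
    rcases Int.isUnit_iff.mp this with h1 | h1 <;> omega
  have hrx : (r * x : ℤ) ≠ 0 := mul_ne_zero hr0' hx0
  obtain ⟨p, hp, hpx, hpa⟩ := exists_prime_dvd_add hrx hc.cop
  obtain ⟨t, ht⟩ := id hpa
  obtain ⟨u, hu⟩ := h.left
  obtain ⟨v, hv⟩ := h4
  have hN2 : (p : ℤ) = 2 * ((p - 1) / 2 : ℕ) + 1 := by
    have h1 := hp.eq_two_or_odd
    have : (p : ℤ) = 4 * (v * (x * t - u)) - 1 := by
      rw [hv] at ht hu; linear_combination ht - hu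
    omega
  set N : ℕ := (p - 1) / 2 with hN
  have hNv : (N : ℤ) + 1 = 2 * v * (x * t - u) := by
    have : 2 * ((N : ℤ) + 1) = 2 * (2 * v * (x * t - u)) := by
      rw [hv] at ht hu
      linear_combination ht - hu - hN2
    linarith
  have hN2v : IsCoprime (N : ℤ) (2 * v) := ⟨-1, x * t - u, by linear_combination -hNv⟩
  have hNtwo : IsCoprime (N : ℤ) 2 := hN2v.of_mul_right_left
  have hNr : IsCoprime (N : ℤ) r := by
    rw [hv, show (4 : ℤ) * v = 2 * (2 * v) by ring]
    exact hNtwo.mul_right hN2v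
  have hNx : IsCoprime (N : ℤ) x :=
    ⟨2 * (y - 1), 1 - r * t * (y - 1), by linear_combination hx1 + (y - 1) * (ht - hN2)⟩
  have hN0 : (N : ℤ) ≠ 0 := by
    have := hp.two_le
    intro h0
    rw [h0] at hNtwo
    have := isCoprime_zero_left.mp hNtwo
    rw [Int.isUnit_iff] at this
    omega
  have hNrx : IsCoprime (N : ℤ) (r * x) := hNr.mul_right hNx
  obtain ⟨α, β, hαβ⟩ := id hNrx
  obtain ⟨b, hb⟩ : ∃ b, b = a * (α * N) + β * (r * x) := ⟨_, rfl⟩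
  have hb1 : b = a + (1 - a) * β * (r * x) := by rw [hb]; linear_combination a * hαβ
  have hb2 : b = 1 + (a - 1) * α * N := by rw [hb]; linear_combination hαβ
  have hbc : IsCoprime b (r * x * N) := by
    refine IsCoprime.mul_right ?_ ?_
    · rw [hb1]; exact (IsCoprime.add_mul_right_left_iff).mpr hc.cop
    · rw [hb2]; exact (IsCoprime.add_mul_right_left_iff).mpr isCoprime_one_left
  obtain ⟨q, hq, hqx, hqb⟩ := exists_prime_dvd_add (mul_ne_zero hrx hN0) hbc
  obtain ⟨m, hm⟩ := hqb
  have hqx' : (r * x : ℤ).natAbs < q := by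
    refine lt_of_le_of_lt (Nat.le_of_dvd ?_ (Int.natAbs_dvd_natAbs.mpr (dvd_mul_right _ _))) hqx
    exact Int.natAbs_pos.mpr (mul_ne_zero hrx hN0)
  have hq2 : (q : ℤ) = 2 * ((q - 1) / 2 : ℕ) + 1 := by
    have h1 : (q : ℤ) = 4 * (v * (x * N * m - u - u * β * x * (-r))) - 1 := by
      rw [hb1] at hm
      linear_combination hm - hu + (x * N * m - u - u * β * x * (-r)) * hv + β * r * x * hu
    omega
  have hqN : IsCoprime (N : ℤ) ((q - 1) / 2 : ℕ) := by
    refine IsCoprime.of_mul_right_right (y := 2) ?_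
    rw [show (2 : ℤ) * ((q - 1) / 2 : ℕ) = -2 + N * (r * x * m - (a - 1) * α) by
      rw [hb2] at hm; linear_combination hm - hq2]
    exact (IsCoprime.add_mul_left_right_iff).mpr hNtwo.neg_right
  refine eq_one_of_pow_eq_one hqN (sg_pow_of_prime hW hr hr0 hjk hc hx0 hp hpx hpa)
    (sg_pow_of_prime hW hr hr0 hjk hc hx0 hq hqx' ⟨m * N - (1 - a) * β, ?_⟩)
  rw [hb1] at hm
  linear_combination hm

/-- The elementary subgroup of level `r` normally generates the congruence subgroup. -/
theorem Gamma_le_of_elemIn (hg : 2 ≤ g) (hW : ElemIn r W) (hr : 4 ∣ r) (hr0 : r ≠ 0) :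
    Gamma g r ≤ W := by
  intro M hM
  have hjk : (⟨1, by omega⟩ : Fin g) ≠ ⟨0, by omega⟩ := by simp
  obtain ⟨w, hw, hwG, hfix⟩ := exists_mul_fix_ne hW inferInstance (by omega)
    (⟨0, by omega⟩ : Fin g) hM
  have hrep : Rep r (⟨0, by omega⟩ : Fin g) _ _ (w * M) := ⟨mul_mem hwG hM, hfix, rfl, rfl⟩
  have h1 := hrep.col.sg_eq_one hW hr hr0 hjk
  rw [hrep.sg_eq hW hr0, QuotientGroup.eq_one_iff] at h1
  exact (Subgroup.mul_mem_cancel_left W hw).mp h1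

end Mennicke

section Commutators

/-- The commutator subgroup of `Γ[d]`, as a subgroup of the symplectic group. -/
abbrev cm (g d : ℕ) : Subgroup (SpZ g) := ⁅Gamma g d, Gamma g d⁆

/-- The standard basis of the lattice. -/
def bb (p : Idx g) : Lat g := Pi.single p 1

lemma bb_inl (k : Fin g) : bb (Sum.inl k) = ee k := rfl

lemma bb_inr (k : Fin g) : bb (Sum.inr k) = ff k := rfl

lemma ei_smul_self (u : Lat g) (c : ℤ) (h : om u (c • u) = 0) : ei u (c • u) h = tv u (2 * c) :=
  sp_ext fun x => by
    simp only [act_ei, act_tv, map_smul, LinearMap.smul_apply, smul_eq_mul]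
    module

variable {d : ℕ}

lemma exists_fin_ne (hg : 2 ≤ g) (k : Fin g) : ∃ j : Fin g, j ≠ k := by
  have : Nontrivial (Fin g) := Fin.nontrivial_iff_two_le.mpr hg
  exact exists_ne k

lemma tv_mem_cm_of_om {u y y' : Lat g} (hy : om u y = 0) (hy' : om u y' = 0) :
    tv u (2 * d ^ 2 * om y y') ∈ cm g d := by
  have h (z : Lat g) (hz : om u z = 0) : om u ((d : ℤ) • z) = 0 := by rw [map_smul, hz, smul_zero]
  have hc := Subgroup.commutator_mem_commutator (ei_mem_Gamma (d := d) (h y hy))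
    (ei_mem_Gamma (d := d) (h y' hy'))
  convert hc using 1
  rw [commutatorElement_def, ei_inv, ei_inv]
  refine sp_ext fun x => ?_
  have hyu := om_eq_zero_swap hy
  have hyu' := om_eq_zero_swap hy'
  simp only [act_mul_apply, act_tv, act_ei, map_add, map_smul, map_neg, om_self, hy, hy', hyu, hyu',
    om_swap y' y, LinearMap.smul_apply, LinearMap.neg_apply, smul_eq_mul]
  module

lemma tv_ee_mem_cm (hg : 2 ≤ g) (k : Fin g) {c : ℤ} (hc : (2 * d ^ 2 : ℤ) ∣ c) :
    tv (ee k) c ∈ cm g d := by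
  obtain ⟨j, hj⟩ := exists_fin_ne hg k
  obtain ⟨t, rfl⟩ := hc
  have := zpow_mem (tv_mem_cm_of_om (d := d) (u := ee k) (y := ee j) (y' := ff j) (by simp)
    (by simp [ee_inl_ne hj])) t
  rw [tv_zpow] at this
  simpa [mul_comm t] using this

lemma ei_ee_add_mem_cm (hg : 2 ≤ g) (hd : Even d) {k : Fin g} {x y : Lat g}
    (hx : ∀ h, ei (ee k) ((d ^ 2 : ℤ) • x) h ∈ cm g d)
    (hy : ∀ h, ei (ee k) ((d ^ 2 : ℤ) • y) h ∈ cm g d)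
    (hxk : om (ee k) x = 0) (hyk : om (ee k) y = 0) :
    ∀ h, ei (ee k) ((d ^ 2 : ℤ) • (x + y)) h ∈ cm g d := by
  intro h
  have hx' : om (ee k) ((d ^ 2 : ℤ) • x) = 0 := by rw [map_smul, hxk, smul_zero]
  have hy' : om (ee k) ((d ^ 2 : ℤ) • y) = 0 := by rw [map_smul, hyk, smul_zero]
  have h1 := mul_mem (hx hx') (hy hy')
  rw [ei_mul, Subgroup.mul_mem_cancel_left] at h1
  · simpa only [smul_add] using h1
  · refine tv_ee_mem_cm hg k ?_
    obtain ⟨e, rfl⟩ := hd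
    simp only [map_smul, LinearMap.smul_apply, smul_eq_mul]
    exact ⟨2 * e ^ 2 * om x y, by push_cast; ring⟩

lemma ei_ee_mem_cm_of_om (hg : 2 ≤ g) (hd : Even d) {k : Fin g} {y y' : Lat g}
    (hy : om (ee k) y = 0) (hy' : om (ee k) y' = 0) (hyy : om y y' = 1) (c : ℤ) :
    ∀ h, ei (ee k) ((d ^ 2 : ℤ) • c • y) h ∈ cm g d := by
  intro h
  have h1 : om (ee k) ((d : ℤ) • c • y') = 0 := by
    rw [map_smul, map_smul, hy', smul_zero, smul_zero]
  have h2 : om (ee k) (-((d : ℤ) • c • y')) = 0 := by rw [map_neg, h1, neg_zero]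
  have hc := Subgroup.commutator_mem_commutator (tv_mem_Gamma (d := d) (u := y) (dvd_refl (d : ℤ)))
    (ei_mem_Gamma (d := d) h1)
  have ht : tv (ee k) (d ^ 3 * c ^ 2) ∈ cm g d := by
    refine tv_ee_mem_cm hg k ?_
    obtain ⟨e, rfl⟩ := hd
    exact ⟨e * c ^ 2, by push_cast; ring⟩
  have := mul_mem ht hc
  convert this using 1
  rw [commutatorElement_def, ei_conj, ei_inv]
  refine sp_ext fun x => ?_
  have hyk : om y (ee k) = 0 := om_eq_zero_swap hy
  have hyk' : om y' (ee k) = 0 := om_eq_zero_swap hy'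
  have hyy' : om y' y = -1 := by rw [om_swap, hyy]
  simp only [act_mul_apply, act_tv, act_ei, map_add, map_smul, map_neg, om_self, hy, hy', hyk, hyk',
    hyy, LinearMap.add_apply, LinearMap.smul_apply, LinearMap.neg_apply, smul_eq_mul]
  module

lemma ei_ee_mem_cm (hg : 2 ≤ g) (hd : Even d) {k : Fin g} {x : Lat g} (hx : om (ee k) x = 0) :
    ∀ h, ei (ee k) ((d ^ 2 : ℤ) • x) h ∈ cm g d := by
  have hsum : ∀ s : Finset (Fin g), (∀ h, ei (ee k) ((d ^ 2 : ℤ) •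
      ∑ i ∈ s, (x (Sum.inl i) • ee i + x (Sum.inr i) • ff i)) h ∈ cm g d) ∧
      om (ee k) (∑ i ∈ s, (x (Sum.inl i) • ee i + x (Sum.inr i) • ff i)) = 0 := by
    intro s
    induction s using Finset.induction_on with
    | empty =>
      refine ⟨fun h => ?_, by simp⟩
      convert one_mem (cm g d)
      exact sp_ext fun x => by simp
    | insert i s hi ih =>
      rw [Finset.sum_insert hi]
      have hi0 : om (ee k) (x (Sum.inl i) • ee i) = 0 := by simp
      have hi1 : om (ee k) (x (Sum.inr i) • ff i) = 0 := by
        by_cases hik : i = k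
        · subst hik
          rw [om_ee_left] at hx
          simp [hx]
        · simp [ff_inr_ne (Ne.symm hik)]
      have hi2 : om (ee k) (x (Sum.inl i) • ee i + x (Sum.inr i) • ff i) = 0 := by
        rw [map_add, hi0, hi1, add_zero]
      refine ⟨ei_ee_add_mem_cm hg hd (ei_ee_add_mem_cm hg hd ?_ ?_ hi0 hi1) ih.1 hi2 ih.2, ?_⟩
      · by_cases hik : i = k
        · subst hik
          intro h
          have h' : om (ee i) ((d ^ 2 * x (Sum.inl i)) • ee i) = 0 := by simp
          have := tv_ee_mem_cm (d := d) hg i (c := 2 * (d ^ 2 * x (Sum.inl i))) ⟨x (Sum.inl i), by ring⟩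
          rw [← ei_smul_self _ _ h'] at this
          simpa only [mul_smul] using this
        · exact ei_ee_mem_cm_of_om hg hd (y' := ff i) (by simp) (by simp [ee_inl_ne hik])
            (by simp) _
      · by_cases hik : i = k
        · subst hik
          rw [om_ee_left] at hx
          rw [hx]
          intro h
          convert one_mem (cm g d)
          exact sp_ext fun x => by simp
        · exact ei_ee_mem_cm_of_om hg hd (y' := -ee i) (by simp [ee_inl_ne hik]) (by simp)
            (by simp) _
      · rw [map_add, hi2, ih.2, add_zero]
  have h1 := (hsum Finset.univ).1
  have h2 : ∑ i, (x (Sum.inl i) • ee i + x (Sum.inr i) • ff i) = x := by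
    funext j
    rcases j with j | j <;> simp [Finset.sum_apply, ee_inl, ff_inr]
  rwa [h2] at h1

lemma exists_act_ee (k : Fin g) : ∃ γ : SpZ g, act γ (ee k) = ff k :=
  ⟨tv (ee k) (-1) * tv (ff k) (-1), by simp⟩

lemma tv_bb_mem_cm (hg : 2 ≤ g) (p : Idx g) {c : ℤ} (hc : (2 * d ^ 2 : ℤ) ∣ c) :
    tv (bb p) c ∈ cm g d := by
  rcases p with k | k
  · exact tv_ee_mem_cm hg k hc
  · obtain ⟨γ, hγ⟩ := exists_act_ee k
    have := (inferInstance : (cm g d).Normal).conj_mem _ (tv_ee_mem_cm hg k hc) γ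
    rwa [tv_conj, hγ] at this

lemma ei_bb_mem_cm (hg : 2 ≤ g) (hd : Even d) (p : Idx g) {x : Lat g} (hx : om (bb p) x = 0) :
    ∀ h, ei (bb p) ((d ^ 2 : ℤ) • x) h ∈ cm g d := by
  intro h
  rcases p with k | k
  · exact ei_ee_mem_cm hg hd hx h
  · obtain ⟨γ, hγ⟩ := exists_act_ee k
    have h1 : om (ee k) (act γ⁻¹ x) = 0 := by rwa [← om_act γ, hγ, act_act_inv]
    have := (inferInstance : (cm g d).Normal).conj_mem _ (ei_ee_mem_cm hg hd h1
      (by rw [map_smul, h1, smul_zero])) γ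
    rw [ei_conj] at this
    simpa only [hγ, map_smul, act_act_inv, bb_inr] using this

lemma elemIn_cm (hg : 2 ≤ g) (hd : Even d) (hd0 : d ≠ 0) : ElemIn (2 * d ^ 2) (cm g d) := by
  have key : ∀ (p : Idx g) u (h : om (bb p) (((2 * d ^ 2 : ℕ) : ℤ) • u) = 0),
      ei (bb p) (((2 * d ^ 2 : ℕ) : ℤ) • u) h ∈ cm g d := by
    intro p u h
    have h0 : om (bb p) u = 0 := by
      rw [map_smul, smul_eq_zero] at h
      exact h.resolve_left (by exact_mod_cast (by positivity))
    have := ei_bb_mem_cm hg hd p (x := (2 : ℤ) • u) (by rw [map_smul, h0, smul_zero])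
      (by rw [map_smul, map_smul, h0, smul_zero, smul_zero])
    convert this using 2
    rw [smul_smul]
    push_cast
    ring_nf
  refine ⟨fun k c hc => ?_, fun k c hc => ?_, fun k => key (Sum.inl k), fun k => key (Sum.inr k)⟩
  · exact tv_bb_mem_cm hg (Sum.inl k) (by exact_mod_cast hc)
  · exact tv_bb_mem_cm hg (Sum.inr k) (by exact_mod_cast hc)

lemma Gamma_two_mul_sq_le (hg : 2 ≤ g) (hd : Even d) (hd0 : d ≠ 0) :
    Gamma g (2 * d ^ 2) ≤ cm g d := by
  refine Gamma_le_of_elemIn hg (elemIn_cm hg hd hd0) ?_ (by positivity)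
  obtain ⟨e, rfl⟩ := hd
  exact ⟨2 * e ^ 2, by ring⟩

end Commutators

section Commutators

variable {d : ℕ}

/-- The sign of the pairing of a basis vector with its dual basis vector. -/
def sn : Idx g → ℤ := Sum.elim (fun _ => 1) (fun _ => -1)

lemma sn_cast (p : Idx g) : (sn p : ZMod 2) = 1 := by
  rcases p with k | k
  · simp [sn]
  · simp only [sn, Sum.elim_inr]; decide

lemma om_bb_left (p : Idx g) (x : Lat g) : om (bb p) x = sn p * x p.swap := by
  rcases p with k | k
  · simp [bb_inl, sn]
  · simp [bb_inr, sn]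

lemma bb_apply (p q : Idx g) : bb q p = if p = q then 1 else 0 := by
  simp [bb, Pi.single_apply]

lemma act_bb (M : SpZ g) (p q : Idx g) :
    act M (bb q) p = (M : Matrix (Idx g) (Idx g) ℤ) p q := by
  simp [act_apply, bb]

lemma mem_Gamma_iff_bb {M : SpZ g} : M ∈ Gamma g d ↔
    ∀ q, ∃ u : Lat g, act M (bb q) = bb q + (d : ℤ) • u := by
  rw [mem_Gamma_iff_basis]
  exact ⟨fun h q => by rcases q with k | k; exacts [h.1 k, h.2 k], fun h =>
    ⟨fun k => h (Sum.inl k), fun k => h (Sum.inr k)⟩⟩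

lemma Gamma_apply_lat {M : SpZ g} (hM : M ∈ Gamma g d) (x : Lat g) :
    ∃ u : Lat g, act M x = x + (d : ℤ) • u := by
  have h := mem_Gamma_iff.mp hM
  choose N hN using h
  refine ⟨fun i => ∑ j, N i j * x j, funext fun i => ?_⟩
  have h1 : x i = ∑ j, (1 : Matrix (Idx g) (Idx g) ℤ) i j * x j := by
    simp [Matrix.one_apply]
  simp only [act_apply, Matrix.mulVec, dotProduct, Pi.add_apply, Pi.smul_apply, smul_eq_mul]
  rw [h1, Finset.mul_sum, ← Finset.sum_add_distrib]
  exact Finset.sum_congr rfl fun j _ => by linear_combination x j * hN i j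

/-- The infinitesimal symplectic transformation attached to two basis vectors. -/
def qd (p q : Idx g) : Lat g →ₗ[ℤ] Lat g :=
  (om (bb p)).smulRight (bb q) + (om (bb q)).smulRight (bb p)

lemma qd_apply (p q : Idx g) (x : Lat g) :
    qd p q x = om (bb p) x • bb q + om (bb q) x • bb p := rfl

lemma exists_qd_ee_ff (hd : Even d) (k : Fin g) : ∃ w ∈ cm g d, ∀ x, ∃ u, act w x =
    x + (d ^ 2 : ℤ) • qd (Sum.inl k) (Sum.inr k) x + (2 * d ^ 2 : ℤ) • u := by
  refine ⟨_, Subgroup.commutator_mem_commutator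
    (tv_mem_Gamma (d := d) (u := ee k) (dvd_refl (d : ℤ)))
    (tv_mem_Gamma (d := d) (u := ff k) (dvd_refl (d : ℤ))), fun x => ?_⟩
  obtain ⟨e, rfl⟩ := hd
  refine ⟨(e * om (ee k) x) • ee k - (e * om (ff k) x) • ff k
    - ((e + e) * e * om (ff k) x) • ee k, ?_⟩
  have h1 : om (ee k) (ff k) = 1 := by simp
  have h2 : om (ff k) (ee k) = -1 := by simp
  rw [commutatorElement_def, tv_inv, tv_inv, qd_apply, bb_inl, bb_inr]
  simp only [act_mul_apply, act_tv, map_add, map_smul, om_self, h1, h2]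
  push_cast
  module

lemma qd_comm (p q : Idx g) : qd p q = qd q p := add_comm _ _

lemma exists_qd (hg : 2 ≤ g) (hd : Even d) {p q : Idx g} (hpq : p ≠ q) :
    ∃ w ∈ cm g d, ∀ x, ∃ u, act w x =
      x + (d ^ 2 : ℤ) • qd p q x + (2 * d ^ 2 : ℤ) • u := by
  by_cases hs : q = p.swap
  · subst hs
    rcases p with k | k
    · exact exists_qd_ee_ff hd k
    · rw [qd_comm]; exact exists_qd_ee_ff hd k
  · have h0 : om (bb p) (bb q) = 0 := by simp [om_bb_left, bb_apply, Ne.symm hs]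
    have h1 : om (bb p) ((d ^ 2 : ℤ) • bb q) = 0 := by rw [map_smul, h0, smul_zero]
    refine ⟨_, ei_bb_mem_cm hg hd p h0 h1, fun x => ⟨0, ?_⟩⟩
    rw [act_ei, qd_apply, map_smul, LinearMap.smul_apply]
    module

lemma exists_sum_qd (hg : 2 ≤ g) (hd : Even d) (T : Finset (Idx g × Idx g))
    (hT : ∀ t ∈ T, t.1 ≠ t.2) : ∃ w ∈ cm g d, ∀ x, ∃ u, act w x =
      x + (d ^ 2 : ℤ) • ∑ t ∈ T, qd t.1 t.2 x + (2 * d ^ 2 : ℤ) • u := by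
  induction T using Finset.induction_on with
  | empty => exact ⟨1, one_mem _, fun x => ⟨0, by simp⟩⟩
  | insert s T hs ih =>
    obtain ⟨w, hw, hwx⟩ := ih fun t ht => hT t (Finset.mem_insert_of_mem ht)
    obtain ⟨v, hv, hvx⟩ := exists_qd hg hd (hT s (Finset.mem_insert_self s T))
    refine ⟨v * w, mul_mem hv hw, fun x => ?_⟩
    obtain ⟨u, hu⟩ := hwx x
    obtain ⟨u', hu'⟩ := hvx (x + (d ^ 2 : ℤ) • ∑ t ∈ T, qd t.1 t.2 x + (2 * d ^ 2 : ℤ) • u)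
    obtain ⟨e, rfl⟩ := hd
    refine ⟨u + u' + (2 * e ^ 2 : ℤ) • qd s.1 s.2 (∑ t ∈ T, qd t.1 t.2 x)
      + (4 * e ^ 2 : ℤ) • qd s.1 s.2 u, ?_⟩
    rw [Finset.sum_insert hs, act_mul_apply, hu, hu']
    simp only [map_add, map_smul]
    push_cast
    module

lemma mem_cm_of_mem_Gamma_sq (hg : 2 ≤ g) (hd : Even d) (hd0 : d ≠ 0) {M : SpZ g}
    (hM : M ∈ Gamma g (d ^ 2))
    (hdiag : ∀ p, (2 * d ^ 2 : ℤ) ∣ (M : Matrix (Idx g) (Idx g) ℤ) p p.swap) : M ∈ cm g d := by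
  have hd' : (d ^ 2 : ℤ) ≠ 0 := by exact_mod_cast pow_ne_zero 2 hd0
  have h2 : (d : ZMod 2) = 0 := (ZMod.natCast_eq_zero_iff _ _).mpr hd.two_dvd
  choose u hu using mem_Gamma_iff_bb.mp hM
  push_cast at hu
  have hsymm (p q : Idx g) : (u q p : ZMod 2) = u p.swap q.swap := by
    have h := om_act M (bb q) (bb p.swap)
    rw [hu, hu, map_add, map_add, LinearMap.add_apply, LinearMap.add_apply, om_swap _ (bb p.swap)]
      at h
    simp only [map_smul, LinearMap.smul_apply, om_bb_left _ (u _), om_swap _ (bb p.swap),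
      smul_eq_mul, Sum.swap_swap] at h
    have h' : sn q * u p.swap q.swap - sn p.swap * u q p + d ^ 2 * om (u q) (u p.swap) = 0 := by
      refine (mul_eq_zero.mp ?_).resolve_left hd'
      linear_combination h
    have h'' := congrArg (Int.cast (R := ZMod 2)) h'
    push_cast at h''
    rw [sn_cast, sn_cast, h2] at h''
    linear_combination -h''
  have hdiag' (p : Idx g) : (u p.swap p : ZMod 2) = 0 := by
    have h := hdiag p
    rw [← act_bb, hu, Pi.add_apply, bb_apply, if_neg (by rcases p with k | k <;> simp), zero_add,
      Pi.smul_apply, smul_eq_mul, mul_comm (2 : ℤ)] at h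
    exact (ZMod.intCast_zmod_eq_zero_iff_dvd _ 2).mpr ((mul_dvd_mul_iff_left hd').mp h)
  classical
  let T : Finset (Idx g × Idx g) :=
    Finset.univ.filter fun t => toLex t.1 < toLex t.2 ∧ (u t.2.swap t.1 : ZMod 2) ≠ 0
  obtain ⟨w, hw, hwx⟩ := exists_sum_qd hg hd T fun t ht h => by
    simp only [T, Finset.mem_filter, h] at ht
    exact lt_irrefl _ ht.2.1
  have hif (z : ZMod 2) : (if z ≠ 0 then (1 : ZMod 2) else 0) = z := by revert z; decide
  have key (q p : Idx g) : (((∑ t ∈ T, qd t.1 t.2 (bb q)) p : ℤ) : ZMod 2) = u q p := by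
    have h1 (t : Idx g × Idx g) : ((qd t.1 t.2 (bb q) p : ℤ) : ZMod 2) =
        (if t = (q.swap, p) then 1 else 0) + (if t = (p, q.swap) then 1 else 0) := by
      obtain ⟨a, b⟩ := t
      simp only [qd_apply, om_bb_left, bb_apply, Pi.add_apply, Pi.smul_apply, smul_eq_mul]
      push_cast
      rw [sn_cast, sn_cast]
      have ha : a.swap = q ↔ a = q.swap := ⟨fun h => by rw [← h, Sum.swap_swap], fun h => by
        rw [h, Sum.swap_swap]⟩
      have hb : b.swap = q ↔ b = q.swap := ⟨fun h => by rw [← h, Sum.swap_swap], fun h => by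
        rw [h, Sum.swap_swap]⟩
      simp only [ha, hb, Prod.mk.injEq, eq_comm (a := p), ite_and, mul_ite, mul_one,
        mul_zero]
      split_ifs <;> simp_all
    rw [Finset.sum_apply, Int.cast_sum, Finset.sum_congr rfl fun t _ => h1 t,
      Finset.sum_add_distrib, Finset.sum_ite_eq', Finset.sum_ite_eq']
    simp only [T, Finset.mem_filter, Finset.mem_univ, true_and, Sum.swap_swap]
    rcases lt_trichotomy (toLex p) (toLex q.swap) with h | h | h
    · simp only [h, h.not_gt, false_and, true_and, if_false, zero_add, hif]
    · have h' : p = q.swap := toLex.injective h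
      subst h'
      have := hdiag' q.swap
      rw [Sum.swap_swap] at this
      simp [this]
    · simp only [h, h.not_gt, false_and, true_and, if_false, add_zero, hif, hsymm p q]
  have hN : w⁻¹ * M ∈ Gamma g (2 * d ^ 2) := by
    refine mem_Gamma_iff_bb.mpr fun q => ?_
    obtain ⟨v, hv⟩ := hwx (bb q)
    have h1 (p : Idx g) : (2 : ℤ) ∣ u q p - (∑ t ∈ T, qd t.1 t.2 (bb q)) p := by
      have := (ZMod.intCast_zmod_eq_zero_iff_dvd (u q p - (∑ t ∈ T, qd t.1 t.2 (bb q)) p) 2).mp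
        (by push_cast [key]; exact sub_self _)
      exact_mod_cast this
    choose z hz using h1
    have h2 : u q = ∑ t ∈ T, qd t.1 t.2 (bb q) + (2 : ℤ) • z := funext fun p => by
      rw [Pi.add_apply, Pi.smul_apply, smul_eq_mul, ← hz p]; ring
    refine ⟨act w⁻¹ (z - v), ?_⟩
    rw [act_mul_apply]
    refine act_inv_eq ?_
    rw [map_add, map_smul, act_act_inv, hu, hv, h2]
    push_cast
    module
  exact (Subgroup.mul_mem_cancel_left _ (inv_mem hw)).mp (Gamma_two_mul_sq_le hg hd hd0 hN)

end Commutators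

section Abelianization

variable {d : ℕ}

/-- The displacement of `x` under `M`, divided by the level `d`. -/
def xx (d : ℕ) (M : SpZ g) (x : Lat g) : Lat g := fun p => (act M x p - x p) / d

lemma act_eq_add_xx {M : SpZ g} (hM : M ∈ Gamma g d) (x : Lat g) :
    act M x = x + (d : ℤ) • xx d M x := by
  obtain ⟨u, hu⟩ := Gamma_apply_lat hM x
  refine funext fun p => ?_
  rw [Pi.add_apply, Pi.smul_apply, smul_eq_mul, xx, Int.mul_ediv_cancel', add_sub_cancel]
  exact ⟨u p, by rw [hu, Pi.add_apply, Pi.smul_apply, smul_eq_mul, add_sub_cancel_left]⟩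

lemma xx_eq (hd0 : d ≠ 0) {M : SpZ g} {x u : Lat g} (h : act M x = x + (d : ℤ) • u) :
    xx d M x = u := funext fun p => by
  rw [xx, h, Pi.add_apply, Pi.smul_apply, smul_eq_mul, add_sub_cancel_left,
    Int.mul_ediv_cancel_left _ (by exact_mod_cast hd0)]

lemma xx_mul (hd0 : d ≠ 0) {M N : SpZ g} (hM : M ∈ Gamma g d) (hN : N ∈ Gamma g d) (x : Lat g) :
    xx d (M * N) x = xx d M x + xx d N x + (d : ℤ) • xx d M (xx d N x) := by
  refine xx_eq hd0 ?_
  rw [act_mul_apply, act_eq_add_xx hN, map_add, map_smul, act_eq_add_xx hM x,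
    act_eq_add_xx hM (xx d N x)]
  module

lemma om_xx (hd0 : d ≠ 0) {M : SpZ g} (hM : M ∈ Gamma g d) (x y : Lat g) :
    om x (xx d M y) + om (xx d M x) y + d * om (xx d M x) (xx d M y) = 0 := by
  have h := om_act M x y
  rw [act_eq_add_xx hM x, act_eq_add_xx hM y] at h
  simp only [map_add, map_smul, LinearMap.add_apply, LinearMap.smul_apply, smul_eq_mul] at h
  refine (mul_eq_zero.mp ?_).resolve_left (by exact_mod_cast hd0 : (d : ℤ) ≠ 0)
  linear_combination h

/-- The standard quadratic refinement of the symplectic form modulo two. -/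
def qf (x : Lat g) : ℤ := ∑ k, x (Sum.inl k) * x (Sum.inr k)

lemma exists_qf_add (x y : Lat g) : ∃ t, qf (x + y) = qf x + qf y + om x y + 2 * t := by
  refine ⟨∑ k, x (Sum.inr k) * y (Sum.inl k), ?_⟩
  simp only [qf, om_apply, Finset.mul_sum, ← Finset.sum_add_distrib, Pi.add_apply]
  exact Finset.sum_congr rfl fun k _ => by ring

lemma qf_smul (c : ℤ) (x : Lat g) : qf (c • x) = c ^ 2 * qf x := by
  simp only [qf, Finset.mul_sum, Pi.smul_apply, smul_eq_mul]
  exact Finset.sum_congr rfl fun k _ => by ring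

lemma qf_bb (p : Idx g) : qf (bb p) = 0 :=
  Finset.sum_eq_zero fun k _ => by rcases p with j | j <;> simp [bb_apply]

lemma exists_sn (p : Idx g) : ∃ s, sn p = 1 + 2 * s := by
  rcases p with k | k
  · exact ⟨0, rfl⟩
  · exact ⟨-1, rfl⟩

lemma sn_mul_sn (p : Idx g) : sn p * sn p = 1 := by
  rcases p with k | k <;> rfl

lemma swap_ne (p : Idx g) : p.swap ≠ p := by rcases p with k | k <;> simp

lemma swap_eq_iff {p q : Idx g} : p.swap = q ↔ p = q.swap :=
  ⟨fun h => by rw [← h, Sum.swap_swap], fun h => by rw [h, Sum.swap_swap]⟩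

/-- The diagonal part of the abelianization map, valued in `ℤ/2d`. -/
def dg (d : ℕ) (M : SpZ g) (q : Idx g) : ℤ := xx d M (bb q) q.swap + d * qf (xx d M (bb q))

lemma dg_mul (hd : Even d) (hd0 : d ≠ 0) {M N : SpZ g} (hM : M ∈ Gamma g d) (hN : N ∈ Gamma g d)
    (q : Idx g) : ∃ t, dg d (M * N) q = dg d M q + dg d N q + (2 * d) * t := by
  have h := om_xx hd0 hM (bb q) (xx d N (bb q))
  rw [om_bb_left] at h
  obtain ⟨s, hs⟩ := exists_sn q
  obtain ⟨e, he⟩ := hd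
  obtain ⟨t, ht⟩ := exists_qf_add (xx d M (bb q)) (xx d N (bb q))
  obtain ⟨t', ht'⟩ := exists_qf_add (xx d M (bb q) + xx d N (bb q))
    ((d : ℤ) • xx d M (xx d N (bb q)))
  have hde : (d : ℤ) = e + e := by exact_mod_cast he
  rw [map_smul, smul_eq_mul, qf_smul] at ht'
  simp only [dg, xx_mul hd0 hM hN, ht', ht, Pi.add_apply, Pi.smul_apply, smul_eq_mul]
  generalize xx d M (xx d N (bb q)) = z at *
  generalize xx d M (bb q) = u at *
  generalize xx d N (bb q) = v at *
  rw [hs] at h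
  refine ⟨t + t' + d * e * qf z + e * om (u + v) z - s * z q.swap - e * om u z, ?_⟩
  linear_combination (d : ℤ) * h + (d * (d * qf z + om (u + v) z - om u z)) * hde

/-- Pairs of distinct basis indices, in increasing order. -/
abbrev OffPair (g : ℕ) := {t : Idx g × Idx g // toLex t.1 < toLex t.2}

/-- The abelianization map of `Γ[d]`. -/
def ab (hd : Even d) (hd0 : d ≠ 0) :
    Gamma g d →* Multiplicative ((OffPair g → ZMod d) × (Idx g → ZMod (2 * d))) :=
  MonoidHom.mk' (fun M => Multiplicative.ofAdd
    (fun t => (xx d M.1 (bb t.1.2.swap) t.1.1 : ZMod d), fun q => (dg d M.1 q : ZMod (2 * d))))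
    fun M N => by
      rw [← ofAdd_add]
      refine congrArg Multiplicative.ofAdd (Prod.ext (funext fun t => ?_) (funext fun q => ?_))
      · simp only [Subgroup.coe_mul, xx_mul hd0 M.2 N.2, Prod.mk_add_mk, Pi.add_apply,
          Pi.smul_apply, smul_eq_mul]
        push_cast
        rw [ZMod.natCast_self]
        ring
      · obtain ⟨t, ht⟩ := dg_mul hd hd0 M.2 N.2 q
        simp only [Subgroup.coe_mul, Prod.mk_add_mk, Pi.add_apply, ht]
        have h : (2 * d : ZMod (2 * d)) = 0 := by exact_mod_cast ZMod.natCast_self (2 * d)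
        push_cast
        rw [h]
        ring

lemma mem_cm_of_ab_eq_one (hg : 2 ≤ g) (hd : Even d) (hd0 : d ≠ 0) {M : Gamma g d}
    (h : ab hd hd0 M = 1) : (M : SpZ g) ∈ cm g d := by
  obtain ⟨M, hM⟩ := M
  have h1 (t : OffPair g) : (d : ℤ) ∣ xx d M (bb t.1.2.swap) t.1.1 :=
    (ZMod.intCast_zmod_eq_zero_iff_dvd _ d).mp (congrFun (congrArg Prod.fst h) t)
  have h2 (q : Idx g) : ((2 * d : ℕ) : ℤ) ∣ xx d M (bb q) q.swap + d * qf (xx d M (bb q)) :=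
    (ZMod.intCast_zmod_eq_zero_iff_dvd _ (2 * d)).mp (congrFun (congrArg Prod.snd h) q)
  push_cast at h2
  have h3 (q p : Idx g) : (d : ℤ) ∣ xx d M (bb q) p := by
    rcases lt_trichotomy (toLex p) (toLex q.swap) with hlt | heq | hlt
    · simpa using h1 ⟨(p, q.swap), hlt⟩
    · rw [toLex.injective heq]
      exact (Int.dvd_add_left (dvd_mul_right _ _)).mp ((dvd_mul_left _ _).trans (h2 q))
    · obtain ⟨c, hc⟩ := h1 ⟨(q.swap, p), hlt⟩
      have hs := om_xx hd0 hM (bb q) (bb p.swap)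
      rw [om_bb_left, om_swap _ (bb p.swap), om_bb_left, Sum.swap_swap, hc] at hs
      refine ⟨sn p.swap * (sn q * c + om (xx d M (bb q)) (xx d M (bb p.swap))), ?_⟩
      linear_combination (-sn p.swap) * hs - xx d M (bb q) p * sn_mul_sn p.swap
  choose v hv using h3
  have hu (q : Idx g) : xx d M (bb q) = (d : ℤ) • v q := funext (hv q)
  refine mem_cm_of_mem_Gamma_sq hg hd hd0 (mem_Gamma_iff_bb.mpr fun q => ⟨v q, ?_⟩) fun p => ?_
  · rw [act_eq_add_xx hM, hu, smul_smul]
    push_cast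
    rw [sq]
  · obtain ⟨e, he⟩ := hd
    have hde : (d : ℤ) = e + e := by exact_mod_cast he
    obtain ⟨c, hc⟩ := h2 p.swap
    rw [← act_bb, act_eq_add_xx hM, Pi.add_apply, bb_apply, if_neg (swap_ne p).symm, zero_add,
      Pi.smul_apply, smul_eq_mul]
    rw [Sum.swap_swap, hu p.swap, qf_smul, ← hu] at hc
    refine ⟨c - d * e * qf (v p.swap), ?_⟩
    linear_combination (d : ℤ) * hc - (d ^ 3 * qf (v p.swap)) * hde

lemma ab_surjective (hd : Even d) (hd0 : d ≠ 0) : Function.Surjective (ab (g := g) hd hd0) := by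
  let R : AddSubgroup ((OffPair g → ZMod d) × (Idx g → ZMod (2 * d))) :=
    (MonoidHom.toAdditiveLeft (ab hd hd0)).range
  have hR (M : SpZ g) (hM : M ∈ Gamma g d) :
      ((fun t => (xx d M (bb t.1.2.swap) t.1.1 : ZMod d), fun q => (dg d M q : ZMod (2 * d))) :
        (OffPair g → ZMod d) × (Idx g → ZMod (2 * d))) ∈ R :=
    ⟨Additive.ofMul ⟨M, hM⟩, rfl⟩
  have htv (u x : Lat g) (c : ℤ) : xx d (tv u (d * c)) x = (c * om u x) • u :=
    xx_eq hd0 (by rw [act_tv]; module)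
  have h1 (b : Idx g → ZMod (2 * d)) : ((0 : OffPair g → ZMod d), b) ∈ R := by
    classical
    refine AddSubgroup.pi_mem_of_single_mem (H := R.comap (AddMonoidHom.inr _ _)) b fun p => ?_
    obtain ⟨c, hc⟩ := ZMod.intCast_surjective (b p)
    have h := hR (tv (bb p.swap) (d * (c * sn p.swap))) (tv_mem_Gamma (dvd_mul_right _ _))
    simp only [dg, htv, qf_smul, qf_bb, mul_zero, add_zero, om_bb_left, Pi.smul_apply,
      smul_eq_mul, Sum.swap_swap, bb_apply] at h
    refine (congrArg (· ∈ R) (Prod.ext (funext fun t => ?_) (funext fun q => ?_))).mpr h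
    · by_cases ht : p = t.1.2.swap ∧ t.1.1 = p.swap
      · exact absurd t.2 (by rw [ht.2, ht.1, Sum.swap_swap]; exact lt_irrefl _)
      · by_cases ht1 : p = t.1.2.swap
        · simp [show t.1.1 ≠ p.swap from fun h => ht ⟨ht1, h⟩]
        · simp [ht1]
    · by_cases hq : q = p
      · subst hq
        have := congrArg (Int.cast (R := ZMod (2 * d))) (sn_mul_sn q.swap)
        push_cast at this
        simp [← hc]
        linear_combination (-(c : ZMod (2 * d))) * this
      · simp [hq, Ne.symm hq]
  have h2 (a : OffPair g → ZMod d) : a ∈ R.map (AddMonoidHom.fst _ _) := by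
    classical
    refine AddSubgroup.pi_mem_of_single_mem a fun t => ?_
    obtain ⟨c, hc⟩ := ZMod.intCast_surjective (a t)
    refine ⟨_, hR (tv (bb t.1.1 + bb t.1.2) (d * (c * sn t.1.2))) (tv_mem_Gamma (dvd_mul_right _ _)),
      funext fun s => ?_⟩
    obtain ⟨⟨p, q⟩, hpq⟩ := t
    obtain ⟨⟨p', q'⟩, hpq'⟩ := s
    simp only at hpq hpq' hc ⊢
    simp only [AddMonoidHom.coe_fst, htv, map_add, LinearMap.add_apply, om_bb_left, Pi.smul_apply,
      Pi.add_apply, smul_eq_mul, bb_apply, Sum.swap_swap, swap_eq_iff, Pi.single_apply,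
      Subtype.mk.injEq, Prod.mk.injEq]
    have hne : p ≠ q := fun h => by simp [h] at hpq
    have hne' : p' ≠ q' := fun h => by simp [h] at hpq'
    by_cases hq : q = q'
    · subst hq
      by_cases hp : p' = p
      · subst hp
        have := congrArg (Int.cast (R := ZMod d)) (sn_mul_sn q)
        push_cast at this
        simp [← hc, hne]
        linear_combination (c : ZMod d) * this
      · simp [hp, hne']
    · by_cases hp : p = q'
      · subst hp
        have h1 : p' ≠ q := fun h => by subst h; exact lt_asymm hpq hpq'
        simp [hne', h1]
      · simp [hq, Ne.symm hq, hp]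
  intro y
  obtain ⟨z, hz, hzy⟩ := h2 (Multiplicative.toAdd y).1
  have := R.add_mem hz (h1 ((Multiplicative.toAdd y).2 - z.2))
  obtain ⟨M, hM⟩ := this
  refine ⟨M.toMul, Multiplicative.toAdd.injective (hM.trans (Prod.ext ?_ ?_))⟩
  · simpa using hzy
  · simp

lemma ker_ab (hg : 2 ≤ g) (hd : Even d) (hd0 : d ≠ 0) :
    (ab (g := g) hd hd0).ker = commutator (Gamma g d) := by
  refine le_antisymm (fun M hM => ?_) (Abelianization.commutator_subset_ker _)
  have h := mem_cm_of_ab_eq_one hg hd hd0 (MonoidHom.mem_ker.mp hM)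
  have h' : (commutator (Gamma g d)).map (Gamma g d).subtype = cm g d := by
    rw [commutator_def, Subgroup.map_commutator, ← MonoidHom.range_eq_map, Subgroup.range_subtype]
  rw [← h'] at h
  obtain ⟨N, hN, hNM⟩ := h
  rwa [← Subtype.ext hNM]

lemma card_idx : Fintype.card (Idx g) = 2 * g := by
  simp [two_mul]

lemma card_offPair : Fintype.card (OffPair g) = 2 * g ^ 2 - g := by
  have h1 : (Finset.univ.filter fun t : Idx g × Idx g => toLex t.1 < toLex t.2).card =
      (Finset.univ.filter fun t : Idx g × Idx g => toLex t.2 < toLex t.1).card :=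
    Finset.card_equiv (Equiv.prodComm _ _) (by simp)
  have h2 : (Finset.univ : Finset (Idx g)).offDiag =
      (Finset.univ.filter fun t : Idx g × Idx g => toLex t.1 < toLex t.2) ∪
      (Finset.univ.filter fun t : Idx g × Idx g => toLex t.2 < toLex t.1) := by
    ext t
    simp only [Finset.mem_offDiag, Finset.mem_univ, true_and, Finset.mem_union, Finset.mem_filter,
      lt_or_lt_iff_ne, ne_eq, EmbeddingLike.apply_eq_iff_eq]
  have h3 := congrArg Finset.card h2
  rw [Finset.card_union_of_disjoint (Finset.disjoint_filter.mpr fun t _ h => h.not_gt),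
    Finset.offDiag_card, Finset.card_univ, card_idx, ← h1] at h3
  rw [Fintype.card_subtype]
  have h4 : 2 * g * (2 * g) = 2 * (2 * g ^ 2) := by ring
  rw [h4] at h3
  omega

end Abelianization

end SpLevel

/-- Corollary 2.2 (even case): for `g ≥ 2` and even `d ≥ 2`,
`H_1(Γ_g[d]; ℤ) ≅ (ℤ/dℤ)^{2g²−g} × (ℤ/2dℤ)^{2g}`. -/
theorem abelianization_Gamma_of_even (g d : ℕ) (hg : 2 ≤ g) (hd : 2 ≤ d) (hdeven : Even d) :
    Nonempty (Abelianization ↥(Gamma g d) ≃*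
      Multiplicative ((Fin (2 * g ^ 2 - g) → ZMod d) × (Fin (2 * g) → ZMod (2 * d)))) := by
  have hd0 : d ≠ 0 := by omega
  refine ⟨(QuotientGroup.quotientMulEquivOfEq (SpLevel.ker_ab hg hdeven hd0).symm).trans
    ((QuotientGroup.quotientKerEquivOfSurjective _ (SpLevel.ab_surjective hdeven hd0)).trans
      (AddEquiv.toMultiplicative (AddEquiv.prodCongr ?_ ?_)))⟩
  · exact (LinearEquiv.funCongrLeft ℤ (ZMod d)
      (Fintype.equivFinOfCardEq SpLevel.card_offPair).symm).toAddEquiv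
  · exact (LinearEquiv.funCongrLeft ℤ (ZMod (2 * d))
      (Fintype.equivFinOfCardEq SpLevel.card_idx).symm).toAddEquiv
end

section
/- Let g ≥ 2 and d ≥ 2. The map m : Γ_g[d] → (ℤ/dℤ)^{2g²+g} defined by m(A) := ({p_{ij}(A) mod d}_{1≤i,j≤g}, {q_{ij}(A) mod d}_{1≤i≤j≤g}, {r_{ij}(A) mod d}_{1≤i≤j≤g}) is a surjective group homomorphism whose kernel is Γ_g[d²]; in particular there is an exact sequence 1 → Γ_g[d²] → Γ_g[d] → (ℤ/dℤ)^{2g²+g} → 1. -/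
open Matrix

/-- The `(i,j)` entry of the matrix `A' = (A - I)/d`. -/
def entryDiv (g d : ℕ) (A : ↥(SpZ g)) (i j : Idx g) : ℤ :=
  ((A : Matrix (Idx g) (Idx g) ℤ) i j - (1 : Matrix (Idx g) (Idx g) ℤ) i j) / (d : ℤ)

/-- The map `m : Γ_g[d] → (ℤ/dℤ)^{2g²+g}` picking out the `p`-block, the upper triangular
part of the `q`-block and the upper triangular part of the `r`-block of `A' = (A-I)/d`,
reduced mod `d`. -/
def mMap (g d : ℕ) (A : ↥(Gamma g d)) :
    ((Fin g × Fin g) → ZMod d) × ({p : Fin g × Fin g // p.1 ≤ p.2} → ZMod d) ×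
      ({p : Fin g × Fin g // p.1 ≤ p.2} → ZMod d) :=
  ⟨fun p => (entryDiv g d (A : ↥(SpZ g)) (Sum.inl p.1) (Sum.inl p.2) : ZMod d),
   fun p => (entryDiv g d (A : ↥(SpZ g)) (Sum.inl p.1.1) (Sum.inr p.1.2) : ZMod d),
   fun p => (entryDiv g d (A : ↥(SpZ g)) (Sum.inr p.1.1) (Sum.inl p.1.2) : ZMod d)⟩

/-- If `A ≡ 1` mod `d`, then `A - 1` is `d` times the matrix of the `entryDiv g d A i j`. -/
lemma coe_eq_one_add_smul {g d : ℕ} {A : ↥(SpZ g)} (hA : A ∈ Gamma g d) :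
    (A : Matrix (Idx g) (Idx g) ℤ) = 1 + (d : ℤ) • Matrix.of (entryDiv g d A) := by
  ext i j
  have h := Int.mul_ediv_cancel' (mem_Gamma_iff.1 hA i j)
  simp only [Matrix.add_apply, Matrix.smul_apply, Matrix.of_apply, smul_eq_mul, entryDiv]
  rw [h]
  ring

lemma entryDiv_eq_of_coe_eq {g d : ℕ} (hd : d ≠ 0) {A : ↥(SpZ g)}
    {X : Matrix (Idx g) (Idx g) ℤ} (h : (A : Matrix (Idx g) (Idx g) ℤ) = 1 + (d : ℤ) • X)
    (i j : Idx g) : entryDiv g d A i j = X i j := by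
  simp [entryDiv, h, hd, -zsmul_eq_mul, -natCast_zsmul]

lemma mem_Gamma_of_coe_eq {g d : ℕ} {A : ↥(SpZ g)}
    {X : Matrix (Idx g) (Idx g) ℤ} (h : (A : Matrix (Idx g) (Idx g) ℤ) = 1 + (d : ℤ) • X) :
    A ∈ Gamma g d :=
  mem_Gamma_iff.2 fun i j => by simp [h, -zsmul_eq_mul, -natCast_zsmul]

lemma entryDiv_mul {g d : ℕ} (hd : d ≠ 0) {A B : ↥(SpZ g)} (hA : A ∈ Gamma g d)
    (hB : B ∈ Gamma g d) (i j : Idx g) :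
    (entryDiv g d (A * B) i j : ZMod d) = entryDiv g d A i j + entryDiv g d B i j := by
  have h : ((A * B : ↥(SpZ g)) : Matrix (Idx g) (Idx g) ℤ) =
      1 + (d : ℤ) • (Matrix.of (entryDiv g d A) + Matrix.of (entryDiv g d B) +
        (d : ℤ) • (Matrix.of (entryDiv g d A) * Matrix.of (entryDiv g d B))) := by
    rw [Submonoid.coe_mul, coe_eq_one_add_smul hA, coe_eq_one_add_smul hB]
    simp only [add_mul, mul_add, one_mul, mul_one, smul_mul_assoc, mul_smul_comm, smul_add]
    abel
  rw [entryDiv_eq_of_coe_eq hd h]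
  simp [-zsmul_eq_mul, -natCast_zsmul]

lemma mMap_mul {g d : ℕ} (hd : d ≠ 0) (A B : ↥(Gamma g d)) :
    mMap g d (A * B) = mMap g d A + mMap g d B := by
  refine Prod.ext ?_ (Prod.ext ?_ ?_) <;> funext p <;>
    exact entryDiv_mul hd A.2 B.2 _ _

/-- The reduction mod `d` of `(A - 1) / d` lies in the symplectic Lie algebra. -/
lemma J_mul_entryDiv_add {g d : ℕ} (hd : d ≠ 0) {A : ↥(SpZ g)} (hA : A ∈ Gamma g d) :
    J (Fin g) (ZMod d) * (Matrix.of (entryDiv g d A)).map (Int.cast : ℤ → ZMod d) +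
      ((Matrix.of (entryDiv g d A)).map (Int.cast : ℤ → ZMod d))ᵀ * J (Fin g) (ZMod d) = 0 := by
  set X := Matrix.of (entryDiv g d A) with hX
  have h := SymplecticGroup.mem_iff'.1 A.2
  rw [coe_eq_one_add_smul hA, ← hX] at h
  have hsmul : (d : ℤ) • (J (Fin g) ℤ * X + Xᵀ * J (Fin g) ℤ +
      (d : ℤ) • (Xᵀ * J (Fin g) ℤ * X)) = 0 := by
    simp only [transpose_add, transpose_one, transpose_smul, add_mul, mul_add, one_mul, mul_one,
      smul_mul_assoc, mul_smul_comm] at h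
    rw [← sub_eq_zero] at h
    rw [← h]
    simp only [smul_add]
    abel
  have hzero := (smul_eq_zero.1 hsmul).resolve_left (by exact_mod_cast hd)
  have hJ : (J (Fin g) ℤ).map (Int.cast : ℤ → ZMod d) = J (Fin g) (ZMod d) := by
    simp [J, Matrix.fromBlocks_map, Matrix.map_neg, Matrix.map_one, Matrix.map_zero]
  have hmod := congrArg (Int.castRingHom (ZMod d)).mapMatrix hzero
  have hd' : ((d : ℕ) : Matrix (Idx g) (Idx g) (ZMod d)) = 0 := by
    rw [← map_natCast (algebraMap (ZMod d) (Matrix (Idx g) (Idx g) (ZMod d))), ZMod.natCast_self,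
      map_zero]
  simp only [map_add, map_mul, map_zero, zsmul_eq_mul, map_natCast, Int.cast_natCast, hd', zero_mul,
    add_zero] at hmod
  simp only [RingHom.mapMatrix_apply, Int.coe_castRingHom, hJ] at hmod
  exact hmod

lemma mMap_eq_zero_iff {g d : ℕ} (hd : d ≠ 0) (A : ↥(Gamma g d)) :
    mMap g d A = 0 ↔ (A : ↥(SpZ g)) ∈ Gamma g (d ^ 2) := by
  have key : (A : ↥(SpZ g)) ∈ Gamma g (d ^ 2) ↔
      ∀ i j, (entryDiv g d (A : ↥(SpZ g)) i j : ZMod d) = 0 := by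
    rw [mem_Gamma_iff]
    refine forall₂_congr fun i j => ?_
    rw [coe_eq_one_add_smul A.2, ZMod.intCast_zmod_eq_zero_iff_dvd]
    simp only [Matrix.add_apply, Matrix.smul_apply, Matrix.of_apply, smul_eq_mul,
      add_sub_cancel_left, sq, Nat.cast_mul]
    exact mul_dvd_mul_iff_left (Nat.cast_ne_zero.2 hd)
  rw [key]
  constructor
  · intro h
    have hp (i j : Fin g) :
        (entryDiv g d (A : ↥(SpZ g)) (Sum.inl i) (Sum.inl j) : ZMod d) = 0 :=
      congrFun (congrArg Prod.fst h) (i, j)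
    have hq (i j : Fin g) (hij : i ≤ j) :
        (entryDiv g d (A : ↥(SpZ g)) (Sum.inl i) (Sum.inr j) : ZMod d) = 0 :=
      congrFun (congrArg (fun x => x.2.1) h) ⟨(i, j), hij⟩
    have hr (i j : Fin g) (hij : i ≤ j) :
        (entryDiv g d (A : ↥(SpZ g)) (Sum.inr i) (Sum.inl j) : ZMod d) = 0 :=
      congrFun (congrArg (fun x => x.2.2) h) ⟨(i, j), hij⟩
    have hsp := J_mul_entryDiv_add hd A.2
    set Y := (Matrix.of (entryDiv g d (A : ↥(SpZ g)))).map (Int.cast : ℤ → ZMod d) with hY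
    rw [← Matrix.fromBlocks_toBlocks Y, J, Matrix.fromBlocks_transpose, Matrix.fromBlocks_multiply,
      Matrix.fromBlocks_multiply, Matrix.fromBlocks_add, ← Matrix.fromBlocks_zero,
      Matrix.fromBlocks_inj] at hsp
    obtain ⟨h11, h12, -, h22⟩ := hsp
    rintro (i | i) (j | j)
    · exact hp i j
    · rcases le_total i j with hij | hij
      · exact hq i j hij
      · have := congrFun (congrFun h22 i) j
        simpa [hY, Matrix.toBlocks₁₂, hq j i hij, add_neg_eq_zero] using this
    · rcases le_total i j with hij | hij
      · exact hr i j hij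
      · have := congrFun (congrFun h11 i) j
        simpa [hY, Matrix.toBlocks₂₁, hr j i hij] using this
    · have := congrFun (congrFun h12 i) j
      simpa [hY, Matrix.toBlocks₁₁, Matrix.toBlocks₂₂, hp j i] using this
  · intro h
    refine Prod.ext ?_ (Prod.ext ?_ ?_) <;> funext p <;> exact h _ _

/-- If `X` is in the symplectic Lie algebra and `X * J * Xᵀ = 0`, then `1 + d • X` is an element
of the level `d` congruence subgroup. -/
lemma exists_Gamma_coe_eq {g d : ℕ} {X : Matrix (Idx g) (Idx g) ℤ}
    (h₁ : X * J (Fin g) ℤ + J (Fin g) ℤ * Xᵀ = 0) (h₂ : X * J (Fin g) ℤ * Xᵀ = 0) :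
    ∃ A : ↥(Gamma g d), ((A : ↥(SpZ g)) : Matrix (Idx g) (Idx g) ℤ) = 1 + (d : ℤ) • X := by
  have hmem : 1 + (d : ℤ) • X ∈ SpZ g := by
    rw [SymplecticGroup.mem_iff]
    calc (1 + (d : ℤ) • X) * J (Fin g) ℤ * (1 + (d : ℤ) • X)ᵀ
        = J (Fin g) ℤ + (d : ℤ) • (X * J (Fin g) ℤ + J (Fin g) ℤ * Xᵀ) +
            (d : ℤ) • (d : ℤ) • (X * J (Fin g) ℤ * Xᵀ) := by
          simp only [transpose_add, transpose_one, transpose_smul, add_mul, mul_add, one_mul,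
            mul_one, smul_mul_assoc, mul_smul_comm, smul_add]
          abel
      _ = J (Fin g) ℤ := by rw [h₁, h₂]; simp
  exact ⟨⟨⟨_, hmem⟩, mem_Gamma_of_coe_eq rfl⟩, rfl⟩

lemma exists_Gamma_upper {g d : ℕ} {S : Matrix (Fin g) (Fin g) ℤ} (hS : Sᵀ = S) :
    ∃ A : ↥(Gamma g d), ((A : ↥(SpZ g)) : Matrix (Idx g) (Idx g) ℤ) =
      1 + (d : ℤ) • Matrix.fromBlocks 0 S 0 0 :=
  exists_Gamma_coe_eq
    (by simp [J, Matrix.fromBlocks_transpose, Matrix.fromBlocks_multiply, Matrix.fromBlocks_add,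
          hS])
    (by simp [J, Matrix.fromBlocks_transpose, Matrix.fromBlocks_multiply])

/-- The conjugate of `[[1, 0], [d S, 1]]` by `[[1, T], [0, 1]]`, for `S` and `T` symmetric. -/
lemma exists_Gamma_conj {g d : ℕ} {S T : Matrix (Fin g) (Fin g) ℤ} (hS : Sᵀ = S) (hT : Tᵀ = T) :
    ∃ A : ↥(Gamma g d), ((A : ↥(SpZ g)) : Matrix (Idx g) (Idx g) ℤ) =
      1 + (d : ℤ) • Matrix.fromBlocks (T * S) (-(T * S * T)) S (-(S * T)) :=
  exists_Gamma_coe_eq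
    (by simp [J, Matrix.fromBlocks_transpose, Matrix.fromBlocks_multiply, Matrix.fromBlocks_add,
          Matrix.transpose_mul, hS, hT, Matrix.mul_assoc])
    (by simp [J, Matrix.fromBlocks_transpose, Matrix.fromBlocks_multiply,
          Matrix.transpose_mul, hS, hT, Matrix.mul_assoc])

lemma exists_symm_extension {g d : ℕ} (Q : {p : Fin g × Fin g // p.1 ≤ p.2} → ZMod d) :
    ∃ S : Matrix (Fin g) (Fin g) ℤ, Sᵀ = S ∧
      ∀ p : {p : Fin g × Fin g // p.1 ≤ p.2}, (S p.1.1 p.1.2 : ZMod d) = Q p := by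
  refine ⟨Matrix.of fun i j => (Q ⟨(min i j, max i j), min_le_max⟩).cast, ?_, ?_⟩
  · ext i j
    simp [min_comm, max_comm]
  · rintro ⟨⟨i, j⟩, hij⟩
    have hij' : i ≤ j := hij
    simp [hij']

/-- Each matrix unit is a product of two symmetric matrices. -/
lemma exists_symm_mul_symm_eq_single {n R : Type*} [Fintype n] [DecidableEq n] [CommSemiring R]
    (i j : n) (a : R) :
    ∃ S T : Matrix n n R, Sᵀ = S ∧ Tᵀ = T ∧ T * S = Matrix.single i j a := by
  by_cases hij : i = j
  · subst hij
    exact ⟨Matrix.single i i a, Matrix.single i i 1, by simp, by simp, by simp⟩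
  · exact ⟨Matrix.single i j a + Matrix.single j i a, Matrix.single i i 1,
      by simp [Matrix.transpose_add, add_comm], by simp, by simp [mul_add, hij]⟩

/-- `mMap` as a homomorphism of additive groups. -/
def mHom (g d : ℕ) (hd : d ≠ 0) : Additive ↥(Gamma g d) →+
    ((Fin g × Fin g) → ZMod d) × ({p : Fin g × Fin g // p.1 ≤ p.2} → ZMod d) ×
      ({p : Fin g × Fin g // p.1 ≤ p.2} → ZMod d) :=
  AddMonoidHom.mk' (fun A => mMap g d A.toMul) fun A B => mMap_mul hd A.toMul B.toMul

lemma mMap_surjective {g d : ℕ} (hd : d ≠ 0) : Function.Surjective (mMap g d) := by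
  have hq (Q) : (0, Q, 0) ∈ (mHom g d hd).range := by
    obtain ⟨S, hS, hSQ⟩ := exists_symm_extension Q
    obtain ⟨A, hA⟩ := exists_Gamma_upper (d := d) hS
    refine ⟨.ofMul A, Prod.ext ?_ (Prod.ext ?_ ?_)⟩ <;> funext p <;>
      simp [mHom, mMap, entryDiv_eq_of_coe_eq hd hA, hSQ]
  have hr (R) : (0, 0, R) ∈ (mHom g d hd).range := by
    obtain ⟨S, hS, hSR⟩ := exists_symm_extension R
    obtain ⟨A, hA⟩ := exists_Gamma_conj (d := d) hS (T := 0) (by simp)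
    refine ⟨.ofMul A, Prod.ext ?_ (Prod.ext ?_ ?_)⟩ <;> funext p <;>
      simp [mHom, mMap, entryDiv_eq_of_coe_eq hd hA, hSR]
  have hp (P) : P ∈ ((AddMonoidHom.fst _ _).comp (mHom g d hd)).range := by
    rw [← Finset.univ_sum_single P]
    refine sum_mem fun ij _ => ?_
    obtain ⟨i, j⟩ := ij
    obtain ⟨S, T, hS, hT, hST⟩ :=
      exists_symm_mul_symm_eq_single i j ((P (i, j)).cast : ℤ)
    obtain ⟨A, hA⟩ := exists_Gamma_conj (d := d) hS hT
    refine ⟨.ofMul A, funext fun ⟨k, l⟩ => ?_⟩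
    by_cases h : i = k ∧ j = l
    · obtain ⟨rfl, rfl⟩ := h
      simp [mHom, mMap, entryDiv_eq_of_coe_eq hd hA, hST]
    · have h' : (k, l) ≠ (i, j) :=
        fun e => h ⟨(congrArg Prod.fst e).symm, (congrArg Prod.snd e).symm⟩
      simp [mHom, mMap, entryDiv_eq_of_coe_eq hd hA, hST, h, h']
  rintro ⟨P, Q, R⟩
  obtain ⟨A, hA⟩ := hp P
  have hmem : (P, Q, R) ∈ (mHom g d hd).range := by
    have e : (P, Q, R) = mHom g d hd A + (0, Q - (mHom g d hd A).2.1, 0) +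
        (0, 0, R - (mHom g d hd A).2.2) := by
      refine Prod.ext ?_ (Prod.ext ?_ ?_)
      · simpa using hA.symm
      · simp
      · simp
    rw [e]
    exact add_mem (add_mem ⟨A, rfl⟩ (hq _)) (hr _)
  obtain ⟨B, hB⟩ := hmem
  exact ⟨B.toMul, hB⟩

/-- The map `m` is a surjective group homomorphism with kernel `Γ_g[d²]`; in particular
`1 → Γ_g[d²] → Γ_g[d] → (ℤ/dℤ)^{2g²+g} → 1` is exact. -/
theorem mMap_hom_surjective_ker (g d : ℕ) (hg : 2 ≤ g) (hd : 2 ≤ d) :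
    (∀ A B : ↥(Gamma g d), mMap g d (A * B) = mMap g d A + mMap g d B) ∧
    Function.Surjective (mMap g d) ∧
    (∀ A : ↥(Gamma g d), mMap g d A = 0 ↔ ((A : ↥(SpZ g)) ∈ Gamma g (d ^ 2))) := by
  have hd0 : d ≠ 0 := by omega
  exact ⟨mMap_mul hd0, mMap_surjective hd0, mMap_eq_zero_iff hd0⟩
end
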